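/- Let n ≥ 2 be an integer and let f ∈ ℤ[X] be nonconstant, squarefree (in ℚ[X]) and weakly intersective. Then there exist c > 0 and X₀ such that for all real X ≥ X₀, the number of n-th power free integers d with |d| ≤ X for which the twist C_d : d·y^n = f(x) is everywhere locally soluble is at least c·X. -/

import Mathlib

open Polynomial

/-- The radical of an integer: the product of its distinct prime factors. -/
def IntRadical (m : ℤ) : ℕ := ∏ p ∈ m.natAbs.primeFactors, p

/-- The abc conjecture of Masser–Oesterlé. -/
def ABCConjecture : Prop :=
  ∀ ε : ℝ, 0 < ε → ∃ K : ℝ, 0 < K ∧ ∀ a b c : ℤ,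
    a ≠ 0 → b ≠ 0 → c ≠ 0 →
    IsCoprime a b → IsCoprime a c → IsCoprime b c →
    a + b = c →
    ((max (max |a| |b|) |c| : ℤ) : ℝ) ≤ K * (IntRadical (a * b * c) : ℝ) ^ (1 + ε)

/-- `d` is `n`-th power free. -/
def NthPowerFree (n : ℕ) (d : ℤ) : Prop :=
  d ≠ 0 ∧ ∀ p : ℕ, p.Prime → ¬ ((p : ℤ) ^ n ∣ d)

/-- A `K`-point of the twist `C_d : d·y^n = f(x)`. -/
def HasTwistPoint (n : ℕ) (f : Polynomial ℤ) (d : ℤ) (K : Type) [CommRing K] : Prop :=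
  ∃ x y : K, (d : K) * y ^ n = Polynomial.aeval x f

/-- The twist `C_d : d·y^n = f(x)` has points everywhere locally. -/
def EverywhereLocallySoluble (n : ℕ) (f : Polynomial ℤ) (d : ℤ) : Prop :=
  HasTwistPoint n f d ℝ ∧ ∀ (p : ℕ) (_ : Fact p.Prime), HasTwistPoint n f d ℚ_[p]

/-- The twist `C_d` violates the Hasse principle. -/
def ViolatesHasse (n : ℕ) (f : Polynomial ℤ) (d : ℤ) : Prop :=
  EverywhereLocallySoluble n f d ∧ ¬ HasTwistPoint n f d ℚ

/-- `f` is weakly intersective: the primes modulo which `f` has a root have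
relative natural density `1` in the primes. -/
def WeaklyIntersective (f : Polynomial ℤ) : Prop :=
  Filter.Tendsto (fun X : ℕ =>
      (Nat.card {ℓ : ℕ // ℓ ≤ X ∧ ℓ.Prime ∧ ∃ x : ZMod ℓ, Polynomial.aeval x f = 0} : ℝ) /
      (Nat.card {ℓ : ℕ // ℓ ≤ X ∧ ℓ.Prime} : ℝ))
    Filter.atTop (nhds 1)

section PrimeDensities

open Filter Topology IsDedekindDomain NumberField

/-- Sieving a completely multiplicative function on ideals by finitely many primes. -/
theorem prod_one_sub_mul_tsum_ideal {R : Type*} [CommRing R] [IsDedekindDomain R]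
    (g : Ideal R →*₀ ℝ) (hs : Summable g) (S : Finset (HeightOneSpectrum R)) :
    (∏ v ∈ S, (1 - g v.asIdeal)) * ∑' I, g I =
      ∑' I, {I : Ideal R | ∀ v ∈ S, ¬ v.asIdeal ∣ I}.indicator g I := by
  classical
  induction S using Finset.induction_on with
  | empty => simp
  | insert v S hv ih =>
    rw [Finset.prod_insert hv, mul_assoc, ih, sub_mul, one_mul, sub_eq_iff_eq_add,
      ← tsum_mul_left]
    have hinj : Function.Injective (fun I : Ideal R => v.asIdeal * I) :=
      fun I J h => mul_left_cancel₀ v.ne_bot h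
    have h2 : ∑' I, g v.asIdeal * {I : Ideal R | ∀ w ∈ S, ¬ w.asIdeal ∣ I}.indicator g I =
        ∑' I, {I : Ideal R | v.asIdeal ∣ I ∧ ∀ w ∈ S, ¬ w.asIdeal ∣ I}.indicator g I := by
      rw [← hinj.tsum_eq (f := {I : Ideal R | v.asIdeal ∣ I ∧
        ∀ w ∈ S, ¬ w.asIdeal ∣ I}.indicator g)]
      · refine tsum_congr fun I => ?_
        have : (∀ w ∈ S, ¬ w.asIdeal ∣ v.asIdeal * I) ↔ (∀ w ∈ S, ¬ w.asIdeal ∣ I) := by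
          refine forall₂_congr fun w hw => not_congr ⟨fun h => ?_, fun h => h.mul_left _⟩
          refine (w.prime.dvd_or_dvd h).resolve_left fun h => hv ?_
          have : w = v := HeightOneSpectrum.ext
            (((prime_dvd_prime_iff_eq w.prime v.prime).1 h))
          exact this ▸ hw
        simp only [Set.indicator_apply, Set.mem_ofPred_eq, dvd_mul_right, true_and, this, map_mul,
          mul_ite, mul_zero]
      · intro I hI
        have := Set.mem_of_indicator_ne_zero hI
        obtain ⟨J, rfl⟩ := this.1
        exact ⟨J, rfl⟩
    rw [h2, ← (hs.indicator _).tsum_add (hs.indicator _)]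
    refine tsum_congr fun I => ?_
    simp only [Set.indicator_apply, Set.mem_ofPred_eq, Finset.forall_mem_insert]
    by_cases h : v.asIdeal ∣ I <;> simp [h]

theorem tendsto_prod_one_sub_mul_tsum_ideal {R : Type*} [CommRing R] [IsDedekindDomain R]
    (g : Ideal R →*₀ ℝ) (hg : ∀ I, 0 ≤ g I) (hs : Summable g) :
    Tendsto (fun S : Finset (HeightOneSpectrum R) =>
      (∏ v ∈ S, (1 - g v.asIdeal)) * ∑' I, g I) atTop (𝓝 1) := by
  classical
  simp_rw [prod_one_sub_mul_tsum_ideal g hs]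
  have h1 : (1 : ℝ) = ∑' I, ({1} : Set (Ideal R)).indicator g I := by
    rw [tsum_eq_single 1]
    · rw [Set.indicator_of_mem (Set.mem_singleton _), map_one]
    · intro I hI
      rw [Set.indicator_of_notMem (by simpa using hI)]
  rw [h1]
  refine tendsto_tsum_of_dominated_convergence hs (fun I => ?_) (Eventually.of_forall fun S I => ?_)
  · apply tendsto_nhds_of_eventually_eq
    by_cases hI : I = 1
    · refine Eventually.of_forall fun S => ?_
      have : ∀ v ∈ S, ¬ v.asIdeal ∣ I := by
        intro v _ h
        exact v.prime.not_isUnit (isUnit_of_dvd_one (hI ▸ h))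
      rw [Set.indicator_of_mem (show I ∈ {I : Ideal R | ∀ v ∈ S, ¬ v.asIdeal ∣ I} from this),
        Set.indicator_of_mem (by simpa using hI)]
    · by_cases h0 : I = 0
      · subst h0
        refine Eventually.of_forall fun S => ?_
        simp only [Set.indicator_apply, map_zero, ite_self]
      obtain ⟨P, hP, hIP⟩ := Ideal.exists_le_maximal I (by simpa [Ideal.one_eq_top] using hI)
      have hPb : P ≠ ⊥ := fun h => h0 (le_bot_iff.1 (h ▸ hIP))
      filter_upwards [eventually_ge_atTop {(⟨P, hP.isPrime, hPb⟩ : HeightOneSpectrum R)}] with S hS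
      rw [Set.indicator_of_notMem, Set.indicator_of_notMem (by simpa using hI)]
      simp only [Set.mem_ofPred_eq, not_forall, not_not]
      exact ⟨_, hS (Finset.mem_singleton_self _), Ideal.dvd_iff_le.2 hIP⟩
  · rw [Real.norm_of_nonneg (Set.indicator_nonneg (fun I _ => hg I) I)]
    exact Set.indicator_le_self' (fun I _ => hg I) I

/-- Taking logarithms in the Euler product over the primes of a Dedekind domain. -/
theorem log_tsum_ideal_bounds {R : Type*} [CommRing R] [IsDedekindDomain R]
    (g : Ideal R →*₀ ℝ) (hg : ∀ I, 0 ≤ g I) (hs : Summable g)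
    (hg2 : ∀ v : HeightOneSpectrum R, g v.asIdeal ≤ 1 / 2) :
    ∑' v : HeightOneSpectrum R, g v.asIdeal ≤ Real.log (∑' I, g I) ∧
    Real.log (∑' I, g I) ≤ ∑' v : HeightOneSpectrum R, g v.asIdeal + 2 * ∑' I, g I ^ 2 := by
  have hinj : Function.Injective (fun v : HeightOneSpectrum R => v.asIdeal) :=
    fun v w h => HeightOneSpectrum.ext h
  have hsv : Summable fun v : HeightOneSpectrum R => g v.asIdeal := hs.comp_injective hinj
  have hZ : 0 < ∑' I, g I := by
    have : g 1 ≤ ∑' I, g I := hs.le_tsum 1 fun I _ => hg I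
    rw [map_one] at this
    linarith
  have hs2 : Summable fun I => g I ^ 2 := by
    refine summable_of_isBigO hs ?_
    have : (fun I => g I ^ 2) =O[cofinite] (fun I => g I * 1) := by
      simp_rw [sq]
      exact (Asymptotics.isBigO_refl _ _).mul
        ((hs.tendsto_cofinite_zero).isBigO_one ℝ)
    simpa using this
  have hpos : ∀ v : HeightOneSpectrum R, 0 < 1 - g v.asIdeal := fun v => by
    linarith [hg2 v]
  have hlim : Tendsto (fun S : Finset (HeightOneSpectrum R) =>
      ∑ v ∈ S, -Real.log (1 - g v.asIdeal)) atTop (𝓝 (Real.log (∑' I, g I))) := by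
    have := (tendsto_prod_one_sub_mul_tsum_ideal g hg hs).log one_ne_zero
    rw [Real.log_one] at this
    have h2 := (tendsto_const_nhds (x := Real.log (∑' I, g I))).sub this
    rw [sub_zero] at h2
    refine h2.congr fun S => ?_
    rw [Real.log_mul (Finset.prod_pos fun v _ => hpos v).ne' hZ.ne',
      Real.log_prod (fun v _ => (hpos v).ne'), Finset.sum_neg_distrib]
    ring
  constructor
  · refine le_of_tendsto_of_tendsto hsv.hasSum hlim (Eventually.of_forall fun S => ?_)
    refine Finset.sum_le_sum fun v _ => ?_
    have := Real.log_le_sub_one_of_pos (hpos v)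
    linarith
  · refine le_of_tendsto hlim (Eventually.of_forall fun S => ?_)
    have : ∑ v ∈ S, -Real.log (1 - g v.asIdeal) ≤ ∑ v ∈ S, (g v.asIdeal + 2 * g v.asIdeal ^ 2) := by
      refine Finset.sum_le_sum fun v _ => ?_
      have h0 := hg v.asIdeal
      have h1 := hg2 v
      have h2 := Real.one_sub_inv_le_log_of_pos (hpos v)
      have h3 : (1 - g v.asIdeal)⁻¹ ≤ 1 + g v.asIdeal + 2 * g v.asIdeal ^ 2 := by
        rw [inv_le_iff_one_le_mul₀ (hpos v)]
        nlinarith [mul_nonneg (sq_nonneg (g v.asIdeal)) (sub_nonneg.2 h1)]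
      linarith
    refine this.trans ?_
    rw [Finset.sum_add_distrib, ← Finset.mul_sum]
    refine add_le_add (hsv.sum_le_tsum _ fun v _ => hg _)
      (mul_le_mul_of_nonneg_left ?_ zero_le_two)
    have := (hs2.comp_injective hinj).sum_le_tsum S fun v _ => sq_nonneg _
    refine this.trans ?_
    exact (hs2.comp_injective hinj).tsum_le_tsum_of_inj _ hinj (fun _ _ => sq_nonneg _)
      (fun _ => le_rfl) hs2

theorem summable_comp_and_tsum_comp {ι κ : Type*} (φ : ι → κ) (w : κ → ℝ) (hw : ∀ k, 0 ≤ w k)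
    (hfin : ∀ k, Finite {i // φ i = k})
    (hs : Summable fun k => (Nat.card {i // φ i = k} : ℝ) * w k) :
    Summable (fun i => w (φ i)) ∧
      ∑' i, w (φ i) = ∑' k, (Nat.card {i // φ i = k} : ℝ) * w k := by
  have hval : ∀ x : (k : κ) × {i // φ i = k},
      w (φ (Equiv.sigmaFiberEquiv φ x)) = w x.1 := fun x => by
    rw [Equiv.sigmaFiberEquiv_apply, x.2.2]
  have hinner : ∀ k, ∑' _i : {i // φ i = k}, w k = (Nat.card {i // φ i = k} : ℝ) * w k := by
    intro k
    have := hfin k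
    rw [tsum_const, nsmul_eq_mul]
  have hsig : Summable fun x : (k : κ) × {i // φ i = k} => w x.1 := by
    rw [summable_sigma_of_nonneg (fun x => hw x.1)]
    refine ⟨fun k => ?_, ?_⟩
    · have := hfin k
      exact Summable.of_finite
    · simpa only [hinner] using hs
  constructor
  · rw [← (Equiv.sigmaFiberEquiv φ).summable_iff]
    simpa only [Function.comp_def, hval] using hsig
  · rw [← (Equiv.sigmaFiberEquiv φ).tsum_eq]
    simp only [hval]
    rw [hsig.tsum_sigma]
    exact tsum_congr hinner

theorem summable_of_summable_comp {ι κ : Type*} (φ : ι → κ) (w : κ → ℝ) (hw : ∀ k, 0 ≤ w k)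
    (hfin : ∀ k, Finite {i // φ i = k}) (hs : Summable (fun i => w (φ i))) :
    Summable fun k => (Nat.card {i // φ i = k} : ℝ) * w k := by
  have hval : ∀ x : (k : κ) × {i // φ i = k},
      w (φ (Equiv.sigmaFiberEquiv φ x)) = w x.1 := fun x => by
    rw [Equiv.sigmaFiberEquiv_apply, x.2.2]
  rw [← (Equiv.sigmaFiberEquiv φ).summable_iff] at hs
  simp only [Function.comp_def, hval] at hs
  have := ((summable_sigma_of_nonneg (fun x => hw x.1)).1 hs).2
  refine this.congr fun k => ?_
  have := hfin k
  dsimp only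
  rw [tsum_const, nsmul_eq_mul]

section
variable (K : Type*) [Field K] [NumberField K]

theorem tendsto_sum_card_absNorm_div :
    Tendsto (fun n : ℕ => (∑ k ∈ Finset.Icc 1 n,
      (Nat.card {I : Ideal (𝓞 K) // Ideal.absNorm I = k} : ℝ)) / n) atTop
      (𝓝 (dedekindZeta_residue K)) := by
  refine ((Ideal.tendsto_norm_le_div_atTop₀ K).comp tendsto_natCast_atTop_atTop).congr fun n ↦ ?_
  simp only [Function.comp_apply, Nat.cast_le, ← Nat.cast_sum]
  congr
  rw [← add_left_inj 1, ← Ideal.card_norm_le_eq_card_norm_le_add_one,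
    show Finset.Icc 1 n = Finset.Ioc 0 n from Finset.Icc_succ_left_eq_Ioc _ _,
    show 1 = Nat.card {I : Ideal (𝓞 K) // Ideal.absNorm I = 0} by
      simp [Ideal.absNorm_eq_zero_iff],
    Finset.sum_Ioc_add_eq_sum_Icc (n.zero_le),
    ← Finset.card_preimage_eq_sum_card_image_eq
      (fun k _ ↦ Ideal.finite_setOfPred_absNorm_eq k)]
  simp [Set.coe_eq_subtype]

theorem summable_card_absNorm_mul_rpow {s : ℝ} (hs : 1 < s) :
    Summable fun n : ℕ =>
      (Nat.card {I : Ideal (𝓞 K) // Ideal.absNorm I = n} : ℝ) * (n : ℝ) ^ (-s) := by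
  have hO : (fun n : ℕ ↦ ∑ k ∈ Finset.Icc 1 n,
      (Nat.card {I : Ideal (𝓞 K) // Ideal.absNorm I = k} : ℝ)) =O[atTop]
      fun n ↦ (n : ℝ) ^ (1 : ℝ) := by
    have h := (tendsto_sum_card_absNorm_div K).isBigO_one ℝ
    have h2 := h.mul (Asymptotics.isBigO_refl (fun n : ℕ => (n : ℝ)) atTop)
    simp only [Real.rpow_one]
    refine (h2.congr' ?_ ?_)
    · filter_upwards [eventually_ne_atTop 0] with n hn
      have : (n : ℝ) ≠ 0 := Nat.cast_ne_zero.2 hn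
      field_simp
    · simp only [one_mul]; rfl
  have := LSeriesSummable_of_sum_norm_bigO_and_nonneg (s := (s : ℂ)) hO
    (fun _ => Nat.cast_nonneg _) zero_le_one (by simpa using hs)
  have h3 := this.norm
  refine h3.congr fun n => ?_
  rw [LSeries.norm_term_eq]
  split_ifs with h
  · subst h
    rw [Nat.cast_zero, Real.zero_rpow (by linarith), mul_zero]
  · simp [Real.rpow_neg, div_eq_mul_inv]

/-- The completely multiplicative function `I ↦ N(I)⁻ˢ`. -/
noncomputable def absNormRpow (s : ℝ) (hs : s ≠ 0) : Ideal (𝓞 K) →*₀ ℝ where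
  toFun I := (Ideal.absNorm I : ℝ) ^ (-s)
  map_zero' := by simp [hs]
  map_one' := by simp
  map_mul' I J := by
    rw [map_mul, Nat.cast_mul, Real.mul_rpow (Nat.cast_nonneg _) (Nat.cast_nonneg _)]

theorem summable_absNorm_rpow_and_tsum {s : ℝ} (hs : 1 < s) :
    Summable (fun I : Ideal (𝓞 K) => (Ideal.absNorm I : ℝ) ^ (-s)) ∧
    ∑' I : Ideal (𝓞 K), (Ideal.absNorm I : ℝ) ^ (-s) = ∑' n : ℕ,
      (Nat.card {I : Ideal (𝓞 K) // Ideal.absNorm I = n} : ℝ) * (n : ℝ) ^ (-s) :=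
  summable_comp_and_tsum_comp (fun I : Ideal (𝓞 K) => Ideal.absNorm I)
    (fun n : ℕ => (n : ℝ) ^ (-s)) (fun _ => Real.rpow_nonneg (Nat.cast_nonneg _) _)
    (fun k => (Ideal.finite_setOfPred_absNorm_eq k).to_subtype)
    (summable_card_absNorm_mul_rpow K hs)

theorem tendsto_sub_one_mul_tsum_absNorm_rpow :
    Tendsto (fun s : ℝ => (s - 1) * ∑' I : Ideal (𝓞 K), (Ideal.absNorm I : ℝ) ^ (-s)) (𝓝[>] 1)
      (𝓝 (dedekindZeta_residue K)) := by
  have h := (Complex.continuous_re.tendsto _).comp (tendsto_sub_one_mul_dedekindZeta_nhdsGT K)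
  rw [Complex.ofReal_re] at h
  refine h.congr' ?_
  filter_upwards [self_mem_nhdsWithin] with s hs
  rw [(summable_absNorm_rpow_and_tsum K hs).2, Function.comp_apply]
  have : dedekindZeta K s = ((∑' n : ℕ,
      (Nat.card {I : Ideal (𝓞 K) // Ideal.absNorm I = n} : ℝ) * (n : ℝ) ^ (-s) : ℝ) : ℂ) := by
    rw [dedekindZeta, LSeries, Complex.ofReal_tsum]
    refine tsum_congr fun n => ?_
    rw [LSeries.term_def]
    split_ifs with h
    · subst h
      have : (1 : ℝ) < s := hs
      rw [Nat.cast_zero, Real.zero_rpow (by linarith), mul_zero, Complex.ofReal_zero]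
    · rw [Complex.ofReal_mul, Complex.ofReal_cpow (Nat.cast_nonneg _), Complex.ofReal_neg,
        Complex.cpow_neg, div_eq_mul_inv, Complex.ofReal_natCast, Complex.ofReal_natCast]
  rw [this, ← Complex.ofReal_one, ← Complex.ofReal_sub, ← Complex.ofReal_mul, Complex.ofReal_re]

theorem finite_and_card_heightOneSpectrum_under (p : ℕ) (hp : p.Prime) :
    Finite {v : HeightOneSpectrum (𝓞 K) // Ideal.absNorm (v.asIdeal.under ℤ) = p} ∧
    Nat.card {v : HeightOneSpectrum (𝓞 K) // Ideal.absNorm (v.asIdeal.under ℤ) = p} ≤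
      Module.finrank ℚ K := by
  have hp0 : Ideal.span {(p : ℤ)} ≠ ⊥ := by simpa using hp.ne_zero
  have hmax : (Ideal.span {(p : ℤ)}).IsMaximal :=
    have := Fact.mk hp
    Int.ideal_span_isMaximal_of_prime p
  have : Fintype ((Ideal.span {(p : ℤ)}).primesOver (𝓞 K)) :=
    (IsDedekindDomain.primesOver_finite _ _).fintype
  have hf := Ideal.sum_ramification_inertia_eq_finrank (Ideal.span {(p : ℤ)}) (𝓞 K)
  rw [RingOfIntegers.rank] at hf
  let e : {v : HeightOneSpectrum (𝓞 K) // Ideal.absNorm (v.asIdeal.under ℤ) = p} →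
      (Ideal.span {(p : ℤ)}).primesOver (𝓞 K) := fun ⟨v, hv⟩ =>
    ⟨v.asIdeal, v.isPrime, ⟨by rw [← hv, Int.ideal_span_absNorm_eq_self]⟩⟩
  have he : Function.Injective e := fun v w h =>
    Subtype.ext (HeightOneSpectrum.ext (congrArg Subtype.val h))
  refine ⟨Finite.of_injective e he, (Nat.card_le_card_of_injective e he).trans ?_⟩
  rw [Nat.card_eq_fintype_card, ← hf, ← Finset.card_univ, Finset.card_eq_sum_ones]
  refine Finset.sum_le_sum fun q _ => Nat.one_le_iff_ne_zero.2 (mul_ne_zero ?_ ?_)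
  · have := q.2.1
    exact (Ideal.ramificationIdx_pos q.1 ℤ).ne'
  · have := q.2.1
    exact (Ideal.inertiaDeg_pos q.1 ℤ).ne'

theorem summable_inv_absNorm_of_not_prime :
    Summable fun v : {v : HeightOneSpectrum (𝓞 K) // ¬ (Ideal.absNorm v.asIdeal).Prime} =>
      (Ideal.absNorm v.1.asIdeal : ℝ)⁻¹ := by
  have hprime (v : HeightOneSpectrum (𝓞 K)) : (Ideal.absNorm (v.asIdeal.under ℤ)).Prime := by
    have : NeZero v.asIdeal := ⟨v.ne_bot⟩
    exact Nat.absNorm_under_prime v.asIdeal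
  let φ : HeightOneSpectrum (𝓞 K) → Nat.Primes := fun v =>
    ⟨Ideal.absNorm (v.asIdeal.under ℤ), hprime v⟩
  have heq (p : Nat.Primes) (v : HeightOneSpectrum (𝓞 K)) :
      φ v = p ↔ Ideal.absNorm (v.asIdeal.under ℤ) = p := by
    exact Subtype.ext_iff
  have hfin : ∀ p, Finite {v // φ v = p} := fun p => by
    simp only [heq]
    exact (finite_and_card_heightOneSpectrum_under K p p.2).1
  have hcard : ∀ p, (Nat.card {v // φ v = p} : ℝ) ≤ Module.finrank ℚ K := fun p => by
    simp only [heq]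
    exact_mod_cast (finite_and_card_heightOneSpectrum_under K p p.2).2
  have hw : ∀ p : Nat.Primes, (0 : ℝ) ≤ ((p : ℝ) ^ 2)⁻¹ := fun p => by positivity
  have hsum : Summable fun p : Nat.Primes => ((p : ℝ) ^ 2)⁻¹ :=
    (Real.summable_nat_pow_inv.2 one_lt_two).comp_injective Nat.Primes.coe_nat_injective
  have h1 := (summable_comp_and_tsum_comp φ (fun p => ((p : ℝ) ^ 2)⁻¹) hw hfin
    ((hsum.mul_left (Module.finrank ℚ K : ℝ)).of_nonneg_of_le
      (fun p => mul_nonneg (Nat.cast_nonneg _) (hw p))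
      (fun p => mul_le_mul_of_nonneg_right (hcard p) (hw p)))).1
  refine (h1.comp_injective (Subtype.val_injective
    (p := fun v : HeightOneSpectrum (𝓞 K) => ¬ (Ideal.absNorm v.asIdeal).Prime))).of_nonneg_of_le
    (fun v => by positivity) fun ⟨v, hv⟩ => ?_
  have hN := Ideal.absNorm_pow_inertiaDeg (v.asIdeal.under ℤ) v.asIdeal
  have hp := hprime v
  simp only [Function.comp_apply, φ]
  have h2 : 2 ≤ v.asIdeal.inertiaDeg ℤ := by
    by_contra! h
    interval_cases h3 : v.asIdeal.inertiaDeg ℤ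
    · rw [pow_zero] at hN
      exact v.isPrime.ne_top (Ideal.absNorm_eq_one_iff.1 hN.symm)
    · rw [pow_one] at hN
      exact hv (hN ▸ hp)
  have h4 : Ideal.absNorm (v.asIdeal.under ℤ) ^ 2 ≤ Ideal.absNorm v.asIdeal :=
    hN ▸ Nat.pow_le_pow_right hp.pos h2
  have h5 : (0 : ℝ) < (Ideal.absNorm (v.asIdeal.under ℤ) : ℝ) ^ 2 := by
    have := hp.pos
    positivity
  exact inv_anti₀ h5 (by exact_mod_cast h4)
end

/-- `w` has mean value `c` on the primes, in the sense of Dirichlet density. -/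
def HasPrimeMean (w : ℕ → ℝ) (c : ℝ) : Prop :=
  (∀ s : ℝ, 1 < s → Summable fun p : Nat.Primes => w p * (p : ℝ) ^ (-s)) ∧
  Tendsto (fun s : ℝ => (∑' p : Nat.Primes, w p * (p : ℝ) ^ (-s)) / -Real.log (s - 1))
    (𝓝[>] 1) (𝓝 c)

theorem tendsto_neg_log_sub_one : Tendsto (fun s : ℝ => -Real.log (s - 1)) (𝓝[>] 1) atTop := by
  refine tendsto_neg_atBot_atTop.comp (Real.tendsto_log_nhdsGT_zero.comp ?_)
  refine tendsto_nhdsWithin_iff.2 ⟨?_, ?_⟩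
  · have : Tendsto (fun s : ℝ => s - 1) (𝓝 1) (𝓝 (1 - 1)) := (continuous_sub_right 1).tendsto 1
    rw [sub_self] at this
    exact this.mono_left nhdsWithin_le_nhds
  · filter_upwards [self_mem_nhdsWithin] with s hs
    exact sub_pos.2 (Set.mem_Ioi.1 hs)

/-- The degree one primes of a number field have Dirichlet density one. -/
theorem hasPrimeMean_card_absNorm (K : Type*) [Field K] [NumberField K] :
    HasPrimeMean (fun p => (Nat.card {I : Ideal (𝓞 K) // Ideal.absNorm I = p} : ℝ)) 1 := by
  have hinj : Function.Injective (fun v : HeightOneSpectrum (𝓞 K) => v.asIdeal) :=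
    fun v w h => HeightOneSpectrum.ext h
  set A : Set (HeightOneSpectrum (𝓞 K)) := {v | (Ideal.absNorm v.asIdeal).Prime} with hA
  have hsum (s : ℝ) (hs : 1 < s) : Summable fun v : HeightOneSpectrum (𝓞 K) =>
      (Ideal.absNorm v.asIdeal : ℝ) ^ (-s) :=
    (summable_absNorm_rpow_and_tsum K hs).1.comp_injective hinj
  have hN2 (v : HeightOneSpectrum (𝓞 K)) : 2 ≤ Ideal.absNorm v.asIdeal := by
    have h0 : Ideal.absNorm v.asIdeal ≠ 0 := fun h => v.ne_bot (Ideal.absNorm_eq_zero_iff.1 h)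
    have h1 : Ideal.absNorm v.asIdeal ≠ 1 := fun h =>
      v.isPrime.ne_top (Ideal.absNorm_eq_one_iff.1 h)
    omega
  let φ : A → Nat.Primes := fun v => ⟨Ideal.absNorm v.1.asIdeal, v.2⟩
  have hcard (p : Nat.Primes) : Nat.card {v // φ v = p} =
      Nat.card {I : Ideal (𝓞 K) // Ideal.absNorm I = p} := by
    refine Nat.card_congr (Equiv.ofBijective
      (fun v => ⟨v.1.1.asIdeal, congrArg Subtype.val v.2⟩) ⟨?_, ?_⟩)
    · intro v w h
      exact Subtype.ext (Subtype.ext (hinj (congrArg Subtype.val h)))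
    · rintro ⟨I, hI⟩
      have hprime : (Ideal.absNorm I).Prime := hI ▸ p.2
      have h0 : I ≠ ⊥ := fun h => Nat.not_prime_zero (by simpa [h] using hprime)
      exact ⟨⟨⟨⟨I, Ideal.isPrime_of_irreducible_absNorm hprime.prime.irreducible, h0⟩, hprime⟩,
        Subtype.ext hI⟩, rfl⟩
  have hfin (p : Nat.Primes) : Finite {v // φ v = p} := by
    have : Finite {I : Ideal (𝓞 K) // Ideal.absNorm I = p} :=
      (Ideal.finite_setOfPred_absNorm_eq (S := 𝓞 K) p).to_subtype
    refine Finite.of_injective (fun v : {v // φ v = p} =>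
      (⟨v.1.1.asIdeal, congrArg Subtype.val v.2⟩ :
        {I : Ideal (𝓞 K) // Ideal.absNorm I = p})) ?_
    intro v w h
    exact Subtype.ext (Subtype.ext (hinj (congrArg Subtype.val h)))
  have hw (s : ℝ) (p : Nat.Primes) : 0 ≤ (p : ℝ) ^ (-s) := Real.rpow_nonneg (Nat.cast_nonneg _) _
  have hsummable (s : ℝ) (hs : 1 < s) : Summable fun p : Nat.Primes =>
      (Nat.card {I : Ideal (𝓞 K) // Ideal.absNorm I = p} : ℝ) * (p : ℝ) ^ (-s) := by
    simp_rw [← hcard]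
    exact summable_of_summable_comp φ (fun p => (p : ℝ) ^ (-s)) (hw s) hfin
      ((hsum s hs).comp_injective Subtype.val_injective)
  refine ⟨hsummable, ?_⟩
  have htsum (s : ℝ) (hs : 1 < s) : ∑' p : Nat.Primes,
      (Nat.card {I : Ideal (𝓞 K) // Ideal.absNorm I = p} : ℝ) * (p : ℝ) ^ (-s) =
      ∑' v : A, (Ideal.absNorm v.1.asIdeal : ℝ) ^ (-s) := by
    have := hsummable s hs
    simp_rw [← hcard] at this ⊢
    exact (summable_comp_and_tsum_comp φ (fun p => (p : ℝ) ^ (-s)) (hw s) hfin this).2.symm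
  set C₁ := ∑' v : ↥Aᶜ, (Ideal.absNorm v.1.asIdeal : ℝ)⁻¹ with hC₁
  set C₂ := ∑' I : Ideal (𝓞 K), (Ideal.absNorm I : ℝ) ^ (-2 : ℝ) with hC₂
  have hb (s : ℝ) (hs : 1 < s) :
      (∑' v : A, (Ideal.absNorm v.1.asIdeal : ℝ) ^ (-s)) ≤
        Real.log (∑' I : Ideal (𝓞 K), (Ideal.absNorm I : ℝ) ^ (-s)) ∧
      Real.log (∑' I : Ideal (𝓞 K), (Ideal.absNorm I : ℝ) ^ (-s)) ≤
        (∑' v : A, (Ideal.absNorm v.1.asIdeal : ℝ) ^ (-s)) + (C₁ + 2 * C₂) := by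
    have hs0 : s ≠ 0 := by linarith
    have hall := (summable_absNorm_rpow_and_tsum K hs).1
    have hg0 (I : Ideal (𝓞 K)) : 0 ≤ (Ideal.absNorm I : ℝ) ^ (-s) :=
      Real.rpow_nonneg (Nat.cast_nonneg _) _
    have hle (v : HeightOneSpectrum (𝓞 K)) :
        (Ideal.absNorm v.asIdeal : ℝ) ^ (-s) ≤ (Ideal.absNorm v.asIdeal : ℝ)⁻¹ := by
      rw [← Real.rpow_neg_one]
      refine Real.rpow_le_rpow_of_exponent_le ?_ (by linarith)
      exact_mod_cast one_le_two.trans (hN2 v)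
    obtain ⟨h1, h2⟩ := log_tsum_ideal_bounds (absNormRpow K s hs0) hg0 hall (fun v => by
      refine (hle v).trans ?_
      rw [one_div]
      exact inv_anti₀ two_pos (by exact_mod_cast hN2 v))
    change ∑' v : HeightOneSpectrum (𝓞 K), (Ideal.absNorm v.asIdeal : ℝ) ^ (-s) ≤
      Real.log (∑' I : Ideal (𝓞 K), (Ideal.absNorm I : ℝ) ^ (-s)) at h1
    change Real.log (∑' I : Ideal (𝓞 K), (Ideal.absNorm I : ℝ) ^ (-s)) ≤
      ∑' v : HeightOneSpectrum (𝓞 K), (Ideal.absNorm v.asIdeal : ℝ) ^ (-s) +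
      2 * ∑' I : Ideal (𝓞 K), ((Ideal.absNorm I : ℝ) ^ (-s)) ^ 2 at h2
    have hsplit := (hsum s hs).tsum_subtype_add_tsum_subtype_compl A
    have hcompl : ∑' v : ↥Aᶜ, (Ideal.absNorm v.1.asIdeal : ℝ) ^ (-s) ≤ C₁ :=
      ((hsum s hs).comp_injective Subtype.val_injective).tsum_le_tsum (fun v => hle v.1)
        (summable_inv_absNorm_of_not_prime K)
    have hcompl0 : 0 ≤ ∑' v : ↥Aᶜ, (Ideal.absNorm v.1.asIdeal : ℝ) ^ (-s) :=
      tsum_nonneg fun v => hg0 _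
    have hsq (I : Ideal (𝓞 K)) :
        ((Ideal.absNorm I : ℝ) ^ (-s)) ^ 2 ≤ (Ideal.absNorm I : ℝ) ^ (-2 : ℝ) := by
      rcases Nat.eq_zero_or_pos (Ideal.absNorm I) with h | h
      · rw [h, Nat.cast_zero, Real.zero_rpow (by simpa using hs0), Real.zero_rpow (by norm_num)]
        norm_num
      · rw [← Real.rpow_natCast, ← Real.rpow_mul (Nat.cast_nonneg _)]
        refine Real.rpow_le_rpow_of_exponent_le (by exact_mod_cast h) ?_
        push_cast
        linarith
    have h2s := (summable_absNorm_rpow_and_tsum K one_lt_two).1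
    have hC2 : ∑' I : Ideal (𝓞 K), ((Ideal.absNorm I : ℝ) ^ (-s)) ^ 2 ≤ C₂ :=
      (h2s.of_nonneg_of_le (fun _ => sq_nonneg _) hsq).tsum_le_tsum hsq h2s
    constructor <;> linarith
  have hlog : Tendsto (fun s : ℝ =>
      Real.log (∑' I : Ideal (𝓞 K), (Ideal.absNorm I : ℝ) ^ (-s)) / -Real.log (s - 1))
      (𝓝[>] 1) (𝓝 1) := by
    have h1 := (tendsto_sub_one_mul_tsum_absNorm_rpow K).log (dedekindZeta_residue_ne_zero K)
    have h2 := (h1.div_atTop tendsto_neg_log_sub_one).add (tendsto_const_nhds (x := (1 : ℝ)))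
    rw [zero_add] at h2
    refine h2.congr' ?_
    have h3 := (tendsto_sub_one_mul_tsum_absNorm_rpow K).eventually_ne
      (dedekindZeta_residue_ne_zero K)
    filter_upwards [h3, tendsto_neg_log_sub_one.eventually_gt_atTop 0] with s hs hs2
    rw [Real.log_mul (left_ne_zero_of_mul hs) (right_ne_zero_of_mul hs), div_add_one hs2.ne']
    ring
  have hlog2 : Tendsto (fun s : ℝ =>
      (Real.log (∑' I : Ideal (𝓞 K), (Ideal.absNorm I : ℝ) ^ (-s)) - (C₁ + 2 * C₂)) /
        -Real.log (s - 1)) (𝓝[>] 1) (𝓝 1) := by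
    have h2 := hlog.sub ((tendsto_const_nhds (x := C₁ + 2 * C₂)).div_atTop
      tendsto_neg_log_sub_one)
    rw [sub_zero] at h2
    simpa only [sub_div] using h2
  refine tendsto_of_tendsto_of_tendsto_of_le_of_le' hlog2 hlog ?_ ?_
  · filter_upwards [self_mem_nhdsWithin, tendsto_neg_log_sub_one.eventually_gt_atTop 0]
      with s hs hs2
    refine div_le_div_of_nonneg_right ?_ hs2.le
    rw [htsum s hs]
    linarith [(hb s hs).2]
  · filter_upwards [self_mem_nhdsWithin, tendsto_neg_log_sub_one.eventually_gt_atTop 0]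
      with s hs hs2
    refine div_le_div_of_nonneg_right ?_ hs2.le
    rw [htsum s hs]
    exact (hb s hs).1

namespace HasPrimeMean

theorem const_mul {w : ℕ → ℝ} {c : ℝ} (h : HasPrimeMean w c) (a : ℝ) :
    HasPrimeMean (fun p => a * w p) (a * c) := by
  refine ⟨fun s hs => ?_, ?_⟩
  · simpa only [mul_assoc] using (h.1 s hs).mul_left a
  · simp_rw [mul_assoc, tsum_mul_left, mul_div_assoc]
    exact h.2.const_mul a

theorem add {w w' : ℕ → ℝ} {c c' : ℝ} (h : HasPrimeMean w c) (h' : HasPrimeMean w' c') :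
    HasPrimeMean (fun p => w p + w' p) (c + c') := by
  refine ⟨fun s hs => ?_, ?_⟩
  · simpa only [add_mul] using (h.1 s hs).add (h'.1 s hs)
  · refine (h.2.add h'.2).congr' ?_
    filter_upwards [self_mem_nhdsWithin] with s hs
    rw [← add_div, ← (h.1 s hs).tsum_add (h'.1 s hs)]
    simp only [add_mul]

theorem sub {w w' : ℕ → ℝ} {c c' : ℝ} (h : HasPrimeMean w c) (h' : HasPrimeMean w' c') :
    HasPrimeMean (fun p => w p - w' p) (c - c') := by
  simpa only [neg_one_mul, ← sub_eq_add_neg] using h.add (h'.const_mul (-1))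

theorem of_eventually_zero {w : ℕ → ℝ} (N : ℕ) (hw : ∀ p, p.Prime → N < p → w p = 0) :
    HasPrimeMean w 0 := by
  set T : Finset Nat.Primes :=
    (((Set.finite_Iic N).preimage Nat.Primes.coe_nat_injective.injOn).toFinset) with hT
  have hT0 (p : Nat.Primes) (hp : p ∉ T) : w p = 0 := by
    refine hw p p.2 (not_le.1 fun h => hp ?_)
    exact (Set.Finite.mem_toFinset _).2 h
  refine ⟨fun s _ => summable_of_ne_finset_zero (s := T) fun p hp => by rw [hT0 p hp, zero_mul], ?_⟩
  have h1 (s : ℝ) : ∑' p : Nat.Primes, w p * (p : ℝ) ^ (-s) = ∑ p ∈ T, w p * (p : ℝ) ^ (-s) :=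
    tsum_eq_sum fun p hp => by rw [hT0 p hp, zero_mul]
  simp_rw [h1]
  have hcont : Continuous fun s : ℝ => ∑ p ∈ T, w p * (p : ℝ) ^ (-s) := by
    refine continuous_finsetSum _ fun p _ => continuous_const.mul ?_
    exact continuous_const.rpow continuous_neg fun s => Or.inl (Nat.cast_ne_zero.2 p.2.ne_zero)
  exact ((hcont.tendsto 1).mono_left nhdsWithin_le_nhds).div_atTop tendsto_neg_log_sub_one

theorem congr {w w' : ℕ → ℝ} {c : ℝ} (h : HasPrimeMean w c) (N : ℕ)
    (hw : ∀ p, p.Prime → N < p → w' p = w p) : HasPrimeMean w' c := by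
  have := h.add (of_eventually_zero (w := fun p => w' p - w p) N
    fun p hp hN => sub_eq_zero.2 (hw p hp hN))
  simpa using this

theorem sum {ι : Type*} (T : Finset ι) {w : ι → ℕ → ℝ} {c : ι → ℝ}
    (h : ∀ i ∈ T, HasPrimeMean (w i) (c i)) :
    HasPrimeMean (fun p => ∑ i ∈ T, w i p) (∑ i ∈ T, c i) := by
  classical
  induction T using Finset.induction_on with
  | empty => simpa using of_eventually_zero (w := fun _ => 0) 0 fun _ _ _ => rfl
  | insert i T hi ih =>
    simp only [Finset.sum_insert hi]
    exact (h i (Finset.mem_insert_self _ _)).add (ih fun j hj => h j (Finset.mem_insert_of_mem hj))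

end HasPrimeMean

theorem sum_range_mul_le_of_antitone {c w : ℕ → ℝ} {M : ℝ} (hw : Antitone w) (hw0 : ∀ n, 0 ≤ w n)
    (hc : ∀ n, ∑ i ∈ Finset.range n, c i ≤ M) (n : ℕ) :
    ∑ i ∈ Finset.range n, c i * w i ≤ M * w 0 := by
  have key : ∀ n, ∑ i ∈ Finset.range n, c i * w i ≤
      M * (w 0 - w n) + (∑ i ∈ Finset.range n, c i) * w n := by
    intro n
    induction n with
    | zero => simp
    | succ n ih =>
      have h1 := hc (n + 1)
      have h2 := hw (Nat.le_succ n)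
      rw [Finset.sum_range_succ] at h1 ⊢
      rw [Finset.sum_range_succ]
      nlinarith [mul_nonneg (sub_nonneg.2 h1) (sub_nonneg.2 h2)]
  have h1 := key n
  have h2 := mul_nonneg (sub_nonneg.2 (hc n)) (hw0 n)
  linarith

/-- A set of primes of relative natural density zero has Dirichlet density zero. -/
theorem hasPrimeMean_zero_of_tendsto (P : ℕ → Prop) [DecidablePred P]
    (h1 : HasPrimeMean (fun _ => 1) 1)
    (hP : Tendsto (fun X : ℕ => (((Finset.range (X + 1)).filter fun p => p.Prime ∧ P p).card : ℝ) /
      ((Finset.range (X + 1)).filter fun p => p.Prime).card) atTop (𝓝 0)) :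
    HasPrimeMean (fun p => if P p then 1 else 0) 0 := by
  have hw (s : ℝ) (p : Nat.Primes) : 0 ≤ (p : ℝ) ^ (-s) := Real.rpow_nonneg (Nat.cast_nonneg _) _
  have hsP (s : ℝ) (hs : 1 < s) : Summable fun p : Nat.Primes =>
      (if P p then (1 : ℝ) else 0) * (p : ℝ) ^ (-s) := by
    refine (h1.1 s hs).of_nonneg_of_le (fun p => ?_) (fun p => ?_)
    · split_ifs <;> simp [hw]
    · split_ifs <;> simp [hw]
  refine ⟨hsP, ?_⟩
  have hbound (ε : ℝ) (hε : 0 < ε) : ∃ M : ℝ, ∀ s : ℝ, 1 < s →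
      ∑' p : Nat.Primes, (if P p then (1 : ℝ) else 0) * (p : ℝ) ^ (-s) ≤
      ε * ∑' p : Nat.Primes, 1 * (p : ℝ) ^ (-s) + M := by
    obtain ⟨N, hN⟩ := eventually_atTop.1 (hP.eventually_lt_const hε)
    set c : ℕ → ℝ := fun n => if n.Prime then (if P n then 1 else 0) - ε else 0 with hc
    have hcsum (X : ℕ) : ∑ i ∈ Finset.range X, c i =
        ((Finset.range X).filter fun p => p.Prime ∧ P p).card -
          ε * ((Finset.range X).filter fun p => p.Prime).card := by
      simp only [hc]
      rw [← Finset.sum_filter, Finset.sum_sub_distrib, Finset.sum_const, ← Finset.sum_filter,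
        Finset.filter_filter, Finset.sum_const]
      simp [mul_comm]
    have hM (X : ℕ) : ∑ i ∈ Finset.range X, c i ≤ N + 1 := by
      rw [hcsum]
      have hpos : 0 ≤ ε * (((Finset.range X).filter fun p => p.Prime).card : ℝ) := by positivity
      rcases Nat.lt_or_ge N X with h | h
      · obtain ⟨Y, rfl⟩ : ∃ Y, X = Y + 1 := ⟨X - 1, by omega⟩
        have h2 := hN Y (by omega)
        rcases Nat.eq_zero_or_pos ((Finset.range (Y + 1)).filter fun p => p.Prime).card with h0 | h0
        · have : ((Finset.range (Y + 1)).filter fun p => p.Prime ∧ P p).card = 0 := by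
            refine Nat.eq_zero_of_le_zero (h0 ▸ Finset.card_le_card ?_)
            exact Finset.monotone_filter_right _ fun p _ hp => hp.1
          rw [this, h0]
          simp
          positivity
        · rw [div_lt_iff₀ (by exact_mod_cast h0)] at h2
          have : (0 : ℝ) ≤ N := Nat.cast_nonneg _
          linarith
      · have h3 : (((Finset.range X).filter fun p => p.Prime ∧ P p).card : ℝ) ≤ N := by
          refine Nat.cast_le.2 (((Finset.card_filter_le _ _).trans ?_))
          simpa using h
        linarith
    refine ⟨N + 1, fun s hs => ?_⟩
    have hsum : Summable fun p : Nat.Primes => c p * (p : ℝ) ^ (-s) := by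
      refine ((hsP s hs).sub ((h1.1 s hs).mul_left ε)).congr fun p => ?_
      simp only [hc, if_pos p.2]
      ring
    have heq : ∑' p : Nat.Primes, c p * (p : ℝ) ^ (-s) =
        ∑' p : Nat.Primes, (if P p then (1 : ℝ) else 0) * (p : ℝ) ^ (-s) -
          ε * ∑' p : Nat.Primes, 1 * (p : ℝ) ^ (-s) := by
      rw [← tsum_mul_left, ← (hsP s hs).tsum_sub ((h1.1 s hs).mul_left ε)]
      refine tsum_congr fun p => ?_
      simp only [hc, if_pos p.2]
      ring
    suffices ∑' p : Nat.Primes, c p * (p : ℝ) ^ (-s) ≤ N + 1 by linarith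
    set W : ℕ → ℝ := fun n => (max (n : ℝ) 1) ^ (-s) with hW
    have hWanti : Antitone W := fun m n hmn =>
      Real.rpow_le_rpow_of_nonpos (by positivity) (max_le_max_right _ (by exact_mod_cast hmn))
        (by linarith)
    have hW0 : W 0 = 1 := by simp [hW]
    have hcW (n : ℕ) : {p : ℕ | p.Prime}.indicator (fun n => c n * (n : ℝ) ^ (-s)) n =
        c n * W n := by
      by_cases hn : n.Prime
      · rw [Set.indicator_of_mem (show n ∈ {p : ℕ | p.Prime} from hn)]
        simp only [hW]
        rw [max_eq_left (by exact_mod_cast hn.one_lt.le)]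
      · rw [Set.indicator_of_notMem (show n ∉ {p : ℕ | p.Prime} from hn)]
        simp [hc, hn]
    have hs3 : HasSum (fun n => c n * W n) (∑' p : Nat.Primes, c p * (p : ℝ) ^ (-s)) := by
      have := (hasSum_subtype_iff_indicator (s := {p : ℕ | p.Prime})
        (f := fun n : ℕ => c n * (n : ℝ) ^ (-s))).1 hsum.hasSum
      exact this.congr_fun fun n => (hcW n).symm
    refine le_of_tendsto' hs3.tendsto_sum_nat fun n => ?_
    have := sum_range_mul_le_of_antitone hWanti
      (fun n => Real.rpow_nonneg (by positivity) _) hM n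
    rwa [hW0, mul_one] at this
  refine tendsto_order.2 ⟨fun a ha => ?_, fun a ha => ?_⟩
  · filter_upwards [tendsto_neg_log_sub_one.eventually_gt_atTop 0] with s hs
    refine ha.trans_le (div_nonneg (tsum_nonneg fun p => ?_) hs.le)
    split_ifs <;> simp [hw]
  · obtain ⟨M, hM⟩ := hbound (a / 2) (by positivity)
    have hlim := (h1.2.const_mul (a / 2)).add
      ((tendsto_const_nhds (x := M)).div_atTop tendsto_neg_log_sub_one)
    have hlt : a / 2 * 1 + 0 < a := by linarith
    filter_upwards [hlim.eventually_lt_const hlt, self_mem_nhdsWithin,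
      tendsto_neg_log_sub_one.eventually_gt_atTop 0] with s hs hs1 hs0
    refine lt_of_le_of_lt ?_ hs
    rw [← mul_div_assoc, ← add_div]
    exact div_le_div_of_nonneg_right (hM s hs1) hs0.le

open Pointwise
section Frobenius

variable {K : Type*} [Field K] [NumberField K]

theorem exists_forall_notMem_of_ne_zero {δ : 𝓞 K} (hδ : δ ≠ 0) :
    ∃ N : ℕ, ∀ p : ℕ, p.Prime → N < p → ∀ Q : Ideal (𝓞 K), Q.IsPrime → (p : 𝓞 K) ∈ Q → δ ∉ Q := by
  refine ⟨Ideal.absNorm (Ideal.span {δ}), fun p hp hN Q hQ hpQ hδQ => hQ.ne_top ?_⟩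
  have h0 : Ideal.absNorm (Ideal.span {δ}) ≠ 0 := by
    rwa [Ne, Ideal.absNorm_eq_zero_iff, Ideal.span_singleton_eq_bot]
  have hc : IsCoprime ((Ideal.absNorm (Ideal.span {δ}) : ℕ) : ℤ) (p : ℤ) :=
    Nat.isCoprime_iff_coprime.2 ((hp.coprime_iff_not_dvd.2 fun h =>
      (Nat.le_of_dvd (Nat.pos_of_ne_zero h0) h).not_gt hN).symm)
  obtain ⟨a, b, hab⟩ := hc
  have hm : ((Ideal.absNorm (Ideal.span {δ}) : ℕ) : 𝓞 K) ∈ Q :=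
    (Ideal.span_singleton_le_iff_mem Q).2 hδQ (Ideal.absNorm_mem _)
  rw [Ideal.eq_top_iff_one]
  have h1 : (1 : 𝓞 K) = a * (Ideal.absNorm (Ideal.span {δ}) : ℕ) + b * p := by exact_mod_cast hab.symm
  rw [h1]
  exact Q.add_mem (Q.mul_mem_left _ hm) (Q.mul_mem_left _ hpQ)

theorem exists_forall_eq_of_sub_mem (S : Set (𝓞 K)) (hS : S.Finite) :
    ∃ N : ℕ, ∀ p : ℕ, p.Prime → N < p → ∀ Q : Ideal (𝓞 K), Q.IsPrime → (p : 𝓞 K) ∈ Q →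
      ∀ a ∈ S, ∀ b ∈ S, a - b ∈ Q → a = b := by
  classical
  lift S to Finset (𝓞 K) using hS
  obtain ⟨N, hN⟩ := exists_forall_notMem_of_ne_zero (K := K)
    (δ := ∏ x ∈ S.offDiag, (x.1 - x.2)) (by
      refine Finset.prod_ne_zero_iff.2 fun x hx => ?_
      exact sub_ne_zero.2 (Finset.mem_offDiag.1 hx).2.2)
  refine ⟨N, fun p hp hpN Q hQ hpQ a ha b hb hab => ?_⟩
  by_contra hne
  refine hN p hp hpN Q hQ hpQ ?_
  have : (a, b) ∈ S.offDiag := Finset.mem_offDiag.2 ⟨ha, hb, hne⟩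
  rw [← Finset.mul_prod_erase _ _ this]
  exact Q.mul_mem_right _ hab

theorem intCast_pow_sub_mem {R : Type*} [CommRing R] {p : ℕ} (hp : p.Prime) {Q : Ideal R}
    (hpQ : (p : R) ∈ Q) (c : ℤ) : (c : R) ^ p - c ∈ Q := by
  have : Fact p.Prime := ⟨hp⟩
  have h : (p : ℤ) ∣ c ^ p - c := by
    rw [← ZMod.intCast_zmod_eq_zero_iff_dvd]
    push_cast
    rw [ZMod.pow_card, sub_self]
  obtain ⟨k, hk⟩ := h
  have : (c : R) ^ p - c = p * k := by exact_mod_cast congrArg (Int.cast : ℤ → R) hk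
  rw [this]
  exact Q.mul_mem_right _ hpQ

theorem charP_quotient_of_mem {R : Type*} [CommRing R] {p : ℕ} (hp : p.Prime) {Q : Ideal R}
    (hQ : Q ≠ ⊤) (hpQ : (p : R) ∈ Q) : CharP (R ⧸ Q) p := by
  have := Ideal.Quotient.nontrivial_iff.2 hQ
  refine (CharP.charP_iff_prime_eq_zero hp).2 ?_
  rw [← map_natCast (Ideal.Quotient.mk Q)]
  exact Ideal.Quotient.eq_zero_iff_mem.2 hpQ

theorem exists_sub_intCast_mem {R : Type*} [CommRing R] {p : ℕ} (hp : p.Prime) {Q : Ideal R}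
    (hQ : Q.IsPrime) (hpQ : (p : R) ∈ Q) {a : R} (ha : a ^ p - a ∈ Q) : ∃ c : ℤ, a - c ∈ Q := by
  have : Fact p.Prime := ⟨hp⟩
  have := charP_quotient_of_mem hp hQ.ne_top hpQ
  have : CharP (FractionRing (R ⧸ Q)) p :=
    charP_of_injective_algebraMap (IsFractionRing.injective (R ⧸ Q) _) p
  have h1 : (algebraMap (R ⧸ Q) (FractionRing (R ⧸ Q)) (Ideal.Quotient.mk Q a)) ^ p =
      algebraMap (R ⧸ Q) (FractionRing (R ⧸ Q)) (Ideal.Quotient.mk Q a) := by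
    rw [← map_pow, ← map_pow]
    congr 1
    exact (Ideal.Quotient.mk_eq_mk_iff_sub_mem _ _).2 ha
  rw [← Subfield.mem_bot_iff_pow_eq_self, mem_bot_iff_intCast p] at h1
  obtain ⟨c, hc⟩ := h1
  refine ⟨c, (Ideal.Quotient.mk_eq_mk_iff_sub_mem _ _).1 ?_⟩
  apply IsFractionRing.injective (R ⧸ Q) (FractionRing (R ⧸ Q))
  rw [← hc]
  simp

theorem absNorm_eq_prime_iff {p : ℕ} (hp : p.Prime) (I : Ideal (𝓞 K)) :
    Ideal.absNorm I = p ↔ I ≠ ⊤ ∧ (p : 𝓞 K) ∈ I ∧ ∀ y : 𝓞 K, ∃ c : ℤ, y - c ∈ I := by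
  have : Fact p.Prime := ⟨hp⟩
  have key (hI : I ≠ ⊤) (hpI : (p : 𝓞 K) ∈ I) : Ideal.absNorm I = Nat.card (𝓞 K ⧸ I) := rfl
  constructor
  · intro h
    have hpr : I.IsPrime := Ideal.isPrime_of_irreducible_absNorm (h ▸ hp)
    have hpI : (p : 𝓞 K) ∈ I := h ▸ Ideal.absNorm_mem I
    refine ⟨hpr.ne_top, hpI, fun y => ?_⟩
    refine exists_sub_intCast_mem hp hpr hpI ?_
    have hc : Nat.card (𝓞 K ⧸ I) = p := h
    have : Finite (𝓞 K ⧸ I) := Nat.finite_of_card_ne_zero (hc ▸ hp.ne_zero)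
    let _ : Fintype (𝓞 K ⧸ I) := Fintype.ofFinite _
    have := hpr
    let _ := (Finite.isField_of_domain (𝓞 K ⧸ I)).toField
    rw [← Ideal.Quotient.mk_eq_mk_iff_sub_mem, map_pow]
    have := FiniteField.pow_card (Ideal.Quotient.mk I y)
    rwa [← Nat.card_eq_fintype_card, hc] at this
  · rintro ⟨hI, hpI, h⟩
    have := charP_quotient_of_mem hp hI hpI
    have := Ideal.Quotient.nontrivial_iff.2 hI
    have hb : Function.Bijective (ZMod.castHom (dvd_refl p) (𝓞 K ⧸ I)) := by
      refine ⟨RingHom.injective _, fun y => ?_⟩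
      obtain ⟨y, rfl⟩ := Ideal.Quotient.mk_surjective y
      obtain ⟨c, hc⟩ := h y
      refine ⟨c, ?_⟩
      rw [map_intCast, (Ideal.Quotient.mk_eq_mk_iff_sub_mem _ _).2 hc, map_intCast]
    rw [key hI hpI, ← Nat.card_congr (Equiv.ofBijective _ hb), Nat.card_zmod]

end Frobenius

section Frobenius

variable {L : Type*} [Field L] [NumberField L]

/-- `F` is a Frobenius element at the prime `Q` of `L` above `p`. -/
def IsFrobeniusAt (p : ℕ) (Q : Ideal (𝓞 L)) (F : Gal(L/ℚ)) : Prop :=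
  Q.IsPrime ∧ (p : 𝓞 L) ∈ Q ∧ ∀ y : 𝓞 L, F • y - y ^ p ∈ Q

theorem under_int_eq_span {R : Type*} [CommRing R] {p : ℕ} (hp : p.Prime) {Q : Ideal R}
    (hQ : Q ≠ ⊤) (hpQ : (p : R) ∈ Q) : Q.under ℤ = Ideal.span {(p : ℤ)} := by
  have hmax : (Ideal.span {(p : ℤ)}).IsMaximal :=
    PrincipalIdealRing.isMaximal_of_irreducible (Nat.prime_iff_prime_int.1 hp).irreducible
  refine (hmax.eq_of_le ?_ ?_).symm
  · exact Ideal.comap_ne_top _ hQ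
  · rw [Ideal.span_singleton_le_iff_mem]
    simpa [Ideal.under, Ideal.mem_comap] using hpQ

theorem exists_isFrobeniusAt [IsGalois ℚ L] {p : ℕ} (hp : p.Prime) :
    ∃ (Q : Ideal (𝓞 L)) (F : Gal(L/ℚ)), IsFrobeniusAt p Q F := by
  have hmax : (Ideal.span {(p : ℤ)}).IsMaximal :=
    PrincipalIdealRing.isMaximal_of_irreducible (Nat.prime_iff_prime_int.1 hp).irreducible
  obtain ⟨Q, hQ, hQp⟩ := Ideal.exists_ideal_over_maximal_of_isIntegral (S := 𝓞 L)
    (Ideal.span {(p : ℤ)}) (by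
      rw [(RingHom.injective_iff_ker_eq_bot _).1 (FaithfulSMul.algebraMap_injective ℤ (𝓞 L))]
      exact bot_le)
  have hpQ : (p : 𝓞 L) ∈ Q := by
    have : (p : ℤ) ∈ Ideal.comap (algebraMap ℤ (𝓞 L)) Q := hQp ▸ Ideal.mem_span_singleton_self _
    simpa [Ideal.mem_comap] using this
  have hQ0 : Q ≠ ⊥ := by
    rintro rfl
    exact hp.ne_zero (by exact_mod_cast (Ideal.mem_bot.1 hpQ))
  have : Finite (𝓞 L ⧸ Q) := Ideal.finiteQuotientOfFreeOfNeBot Q hQ0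
  have hQpr : Q.IsPrime := hQ.isPrime
  obtain ⟨F, hF⟩ := IsArithFrobAt.exists_of_isInvariant ℤ Gal(L/ℚ) Q
  refine ⟨Q, F, hQpr, hpQ, fun y => ?_⟩
  have := hF y
  have hc : Nat.card (ℤ ⧸ Ideal.under ℤ Q) = p := by
    rw [under_int_eq_span hp hQpr.ne_top hpQ]
    rw [Nat.card_congr (Int.quotientSpanNatEquivZMod p).toEquiv, Nat.card_zmod]
  rw [hc] at this
  exact this

theorem IsFrobeniusAt.pow_sub_mem_of_smul_eq {p : ℕ} {Q : Ideal (𝓞 L)} {F : Gal(L/ℚ)}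
    (h : IsFrobeniusAt p Q F) {a : 𝓞 L} (ha : F • a = a) : a ^ p - a ∈ Q := by
  have := h.2.2 a
  rw [ha] at this
  simpa using Q.neg_mem this

theorem IsFrobeniusAt.smul_sub_mem {p : ℕ} (hp : p.Prime) {Q : Ideal (𝓞 L)} {F : Gal(L/ℚ)}
    (h : IsFrobeniusAt p Q F) {a : 𝓞 L} {c : ℤ} (ha : a - c ∈ Q) : F • a - a ∈ Q := by
  have h1 := h.2.2 a
  have h2 : a ^ p - (c : 𝓞 L) ^ p ∈ Q := Q.mem_of_dvd (sub_dvd_pow_sub_pow _ _ _) ha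
  have h3 := intCast_pow_sub_mem hp h.2.1 c
  have : F • a - a = (F • a - a ^ p) + (a ^ p - (c : 𝓞 L) ^ p) + ((c : 𝓞 L) ^ p - c) - (a - c) := by
    ring
  rw [this]
  exact Q.sub_mem (Q.add_mem (Q.add_mem h1 h2) h3) ha

theorem exists_integer_forall_mem_of_smul_eq [IsGalois ℚ L] (H : Subgroup Gal(L/ℚ)) :
    ∃ α : 𝓞 (IntermediateField.fixedField H), ∀ g : Gal(L/ℚ),
      g • algebraMap _ (𝓞 L) α = algebraMap _ (𝓞 L) α → g ∈ H := by
  set E := IntermediateField.fixedField H with hE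
  obtain ⟨θ, hθ⟩ := Field.exists_primitive_element ℚ E
  have hEalg : Algebra.IsAlgebraic ℤ E :=
    (IsFractionRing.comap_isAlgebraic_iff (A := ℤ) (K := ℚ) (C := E)).2 inferInstance
  obtain ⟨m, hm, hinteg⟩ := (Algebra.IsAlgebraic.isAlgebraic (R := ℤ) θ).exists_integral_multiple
  refine ⟨⟨m • θ, hinteg⟩, fun g hg => ?_⟩
  have h1 : g ((m • θ : E) : L) = ((m • θ : E) : L) :=
    congrArg (algebraMap (𝓞 L) L) hg
  have h2 : g (θ : L) = θ := by
    have hm' : (m : L) ≠ 0 := by exact_mod_cast hm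
    have h3 : ((m • θ : E) : L) = (m : L) * (θ : L) := by
      rw [zsmul_eq_mul]; push_cast; rfl
    rw [h3, map_mul, map_intCast] at h1
    exact mul_left_cancel₀ hm' h1
  rw [← IntermediateField.fixingSubgroup_fixedField H, IntermediateField.mem_fixingSubgroup_iff]
  intro x hx
  have hx' : (⟨x, hx⟩ : E) ∈ IntermediateField.adjoin ℚ {θ} := hθ ▸ IntermediateField.mem_top
  suffices ∀ y ∈ IntermediateField.adjoin ℚ {θ}, g (y : L) = y from this _ hx'
  intro y hy
  induction hy using IntermediateField.adjoin_induction with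
  | mem y hy => rw [Set.mem_singleton_iff.1 hy, h2]
  | algebraMap y => exact g.commutes y
  | add y z _ _ hy hz => push_cast; rw [map_add, hy, hz]
  | inv y _ hy => push_cast; rw [map_inv₀, hy]
  | mul y z _ _ hy hz => push_cast; rw [map_mul, hy, hz]

theorem card_conj_mem_eq_mul_card_absNorm [IsGalois ℚ L] (H : Subgroup Gal(L/ℚ)) :
    ∃ N : ℕ, ∀ p : ℕ, p.Prime → N < p → ∀ (Q : Ideal (𝓞 L)) (F : Gal(L/ℚ)), IsFrobeniusAt p Q F →
      Nat.card {x : Gal(L/ℚ) // x⁻¹ * F * x ∈ H} = Nat.card H *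
        Nat.card {I : Ideal (𝓞 (IntermediateField.fixedField H)) // Ideal.absNorm I = p} := by
  set E := IntermediateField.fixedField H with hE
  set ι := algebraMap (𝓞 E) (𝓞 L) with hι
  obtain ⟨α, hα⟩ : ∃ α : 𝓞 E, ∀ g : Gal(L/ℚ), g • ι α = ι α → g ∈ H :=
    exists_integer_forall_mem_of_smul_eq H
  obtain ⟨N, hN⟩ := exists_forall_eq_of_sub_mem (Set.range fun g : Gal(L/ℚ) => g • ι α)
    (Set.finite_range _)
  refine ⟨N, fun p hp hpN Q F hQF => ?_⟩
  have hQ := hQF.1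
  have hpQ := hQF.2.1
  have hsep (g g' : Gal(L/ℚ)) (h : g • ι α - g' • ι α ∈ Q) : g • ι α = g' • ι α :=
    hN p hp hpN Q hQ hpQ _ ⟨g, rfl⟩ _ ⟨g', rfl⟩ h
  have hfix (g : Gal(L/ℚ)) (hg : g ∈ H) (y : 𝓞 E) : g • ι y = ι y := by
    ext
    exact (IntermediateField.mem_fixedField_iff H _).1 (y : E).2 g hg
  have hmem (g g' : Gal(L/ℚ)) (h : g • ι α = g' • ι α) : g⁻¹ * g' ∈ H := by
    apply hα
    rw [mul_smul, ← h, inv_smul_smul]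
  set J : Gal(L/ℚ) → Ideal (𝓞 E) := fun x =>
    Ideal.comap ((MulSemiringAction.toRingHom Gal(L/ℚ) (𝓞 L) x).comp ι) Q with hJ
  have hJmem (x : Gal(L/ℚ)) (y : 𝓞 E) : y ∈ J x ↔ x • ι y ∈ Q := Iff.rfl
  have hJc (x : Gal(L/ℚ)) (y : 𝓞 E) (c : ℤ) : y - c ∈ J x ↔ x • ι y - c ∈ Q := by
    rw [hJmem, map_sub, smul_sub, map_intCast]
    congr! 2
    exact map_intCast (MulSemiringAction.toRingHom Gal(L/ℚ) (𝓞 L) x) c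
  have hJH (x h : Gal(L/ℚ)) (hh : h ∈ H) : J (x * h) = J x := by
    ext y
    rw [hJmem, hJmem, mul_smul, hfix h hh]
  have hJnorm (x : Gal(L/ℚ)) (hx : x⁻¹ * F * x ∈ H) : Ideal.absNorm (J x) = p := by
    rw [absNorm_eq_prime_iff hp]
    refine ⟨Ideal.comap_ne_top _ hQ.ne_top, ?_, fun y => ?_⟩
    · rw [hJ, Ideal.mem_comap, map_natCast]
      exact hpQ
    · have h1 : F • x • ι y = x • ι y := by
        have := hfix _ hx y
        rw [mul_smul, mul_smul, inv_smul_eq_iff] at this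
        exact this
      obtain ⟨c, hc⟩ := exists_sub_intCast_mem hp hQ hpQ (hQF.pow_sub_mem_of_smul_eq h1)
      exact ⟨c, (hJc x y c).2 hc⟩
  have hJinj (x x' : Gal(L/ℚ)) (hx : Ideal.absNorm (J x) = p) (h : J x = J x') :
      x⁻¹ * x' ∈ H := by
    obtain ⟨c, hc⟩ := ((absNorm_eq_prime_iff hp _).1 hx).2.2 α
    have h1 := (hJc x α c).1 hc
    have h2 := (hJc x' α c).1 (h ▸ hc)
    refine hmem _ _ (hsep _ _ ?_)
    simpa using Q.sub_mem h1 h2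
  have hJsurj (I : Ideal (𝓞 E)) (hI : Ideal.absNorm I = p) :
      ∃ x : Gal(L/ℚ), x⁻¹ * F * x ∈ H ∧ J x = I := by
    have hI' := (absNorm_eq_prime_iff hp I).1 hI
    have hIp : I.IsPrime := Ideal.isPrime_of_irreducible_absNorm (hI ▸ hp)
    obtain ⟨P, -, hP, hPI⟩ := Ideal.exists_ideal_over_prime_of_isIntegral I (⊥ : Ideal (𝓞 L)) (by
      rw [← RingHom.ker_eq_comap_bot, (RingHom.injective_iff_ker_eq_bot _).1
        (FaithfulSMul.algebraMap_injective (𝓞 E) (𝓞 L))]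
      exact bot_le)
    have hpP : (p : 𝓞 L) ∈ P := by
      have := hI'.2.1
      rw [← hPI, Ideal.mem_comap, map_natCast] at this
      exact this
    obtain ⟨g, hg⟩ := Algebra.IsInvariant.exists_smul_of_under_eq ℤ (𝓞 L) Gal(L/ℚ) P Q
      ((under_int_eq_span hp hP.ne_top hpP).trans (under_int_eq_span hp hQ.ne_top hpQ).symm)
    have hJg : J g = I := by
      ext y
      rw [hJmem, hg, Ideal.smul_mem_pointwise_smul_iff, ← hPI, Ideal.mem_comap]
    refine ⟨g, ?_, hJg⟩
    obtain ⟨c, hc⟩ := hI'.2.2 α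
    rw [← hJg, hJc] at hc
    have h1 := hQF.smul_sub_mem hp hc
    rw [← mul_smul] at h1
    have h2 := hmem _ _ (hsep _ _ h1).symm
    rwa [← mul_assoc] at h2
  choose! s hs hsJ using hJsurj
  rw [← Nat.card_prod]
  refine (Nat.card_congr (Equiv.ofBijective (fun z : H × {I : Ideal (𝓞 E) // Ideal.absNorm I = p} =>
    (⟨s z.2 * z.1, ?_⟩ : {x : Gal(L/ℚ) // x⁻¹ * F * x ∈ H})) ⟨?_, ?_⟩)).symm
  · have := H.mul_mem (H.mul_mem (H.inv_mem z.1.2) (hs _ z.2.2)) z.1.2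
    convert this using 1
    group
  · rintro ⟨⟨h, hh⟩, ⟨I, hI⟩⟩ ⟨⟨h', hh'⟩, ⟨I', hI'⟩⟩ heq
    have h1 : s I * h = s I' * h' := congrArg Subtype.val heq
    have h2 : I = I' := by
      rw [← hsJ I hI, ← hsJ I' hI', ← hJH _ h hh, h1, hJH _ h' hh']
    subst h2
    have h3 := mul_left_cancel h1
    subst h3
    rfl
  · rintro ⟨x, hx⟩
    have h1 := hJnorm x hx
    refine ⟨⟨⟨(s (J x))⁻¹ * x, hJinj _ _ ?_ (hsJ _ h1)⟩, ⟨J x, h1⟩⟩, ?_⟩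
    · rw [hsJ _ h1, h1]
    · simp

end Frobenius

section Chebotarev

open Classical in
theorem card_filter_mem_eq_sum_zpowers {α G : Type*} [Fintype α] [Group G] [Finite G] [Fintype (Subgroup G)]
    (a : α → G) (H : Subgroup G) :
    (Finset.univ.filter fun x => a x ∈ H).card =
      (Finset.univ.filter fun x => Subgroup.zpowers (a x) = H).card +
        ∑ H' ∈ Finset.univ.filter (· < H),
          (Finset.univ.filter fun x => Subgroup.zpowers (a x) = H').card := by
  rw [Finset.card_eq_sum_card_fiberwise (f := fun x => Subgroup.zpowers (a x))
    (t := insert H (Finset.univ.filter (· < H))), Finset.sum_insert (by simp)]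
  · congr 1
    · congr 1
      ext x
      simp only [Finset.mem_filter, Finset.mem_univ, true_and, and_iff_right_iff_imp]
      rintro rfl
      exact Subgroup.mem_zpowers _
    · refine Finset.sum_congr rfl fun H' hH' => ?_
      congr 1
      ext x
      simp only [Finset.mem_filter, Finset.mem_univ, true_and, and_iff_right_iff_imp]
      rintro rfl
      exact (Finset.mem_filter.1 hH').2.le (Subgroup.mem_zpowers _)
  · intro x hx
    have hx' : Subgroup.zpowers (a x) ≤ H :=
      Subgroup.zpowers_le.2 (by simpa using hx)
    simpa using hx'.eq_or_lt

variable {L : Type*} [Field L] [NumberField L] [IsGalois ℚ L]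
  {Q : ℕ → Ideal (𝓞 L)} {F : ℕ → Gal(L/ℚ)}

open Classical in
theorem hasPrimeMean_card_conj_mem (hF : ∀ p : ℕ, p.Prime → IsFrobeniusAt p (Q p) (F p))
    (H : Subgroup Gal(L/ℚ)) :
    HasPrimeMean (fun p => ((Finset.univ.filter fun x => x⁻¹ * F p * x ∈ H).card : ℝ))
      ((Finset.univ.filter fun x => x ∈ H).card : ℝ) := by
  obtain ⟨N, hN⟩ := card_conj_mem_eq_mul_card_absNorm H
  have h := (hasPrimeMean_card_absNorm (IntermediateField.fixedField H)).const_mul (Nat.card H : ℝ)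
  rw [mul_one] at h
  have hc : Nat.card H = (Finset.univ.filter fun x => x ∈ H).card :=
    Nat.subtype_card _ (by simp)
  rw [← hc]
  refine h.congr N fun p hp hpN => ?_
  rw [← Nat.subtype_card (p := fun x => x⁻¹ * F p * x ∈ H) _ (by simp)]
  exact_mod_cast hN p hp hpN _ _ (hF p hp)

open Classical in
theorem hasPrimeMean_card_zpowers_conj (hF : ∀ p : ℕ, p.Prime → IsFrobeniusAt p (Q p) (F p))
    (H : Subgroup Gal(L/ℚ)) :
    HasPrimeMean
      (fun p => ((Finset.univ.filter fun x => Subgroup.zpowers (x⁻¹ * F p * x) = H).card : ℝ))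
      ((Finset.univ.filter fun x => Subgroup.zpowers x = H).card : ℝ) := by
  have := Fintype.ofFinite (Subgroup Gal(L/ℚ))
  induction H using WellFoundedLT.induction with
  | ind H ih =>
    have h1 := (hasPrimeMean_card_conj_mem hF H).sub
      (HasPrimeMean.sum (Finset.univ.filter (· < H)) fun H' hH' =>
        ih H' (Finset.mem_filter.1 hH').2)
    convert h1 using 1
    · ext p
      rw [card_filter_mem_eq_sum_zpowers]
      push_cast
      ring
    · rw [card_filter_mem_eq_sum_zpowers]
      push_cast
      ring

theorem hasPrimeMean_one (hF : ∀ p : ℕ, p.Prime → IsFrobeniusAt p (Q p) (F p)) :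
    HasPrimeMean (fun _ => 1) 1 := by
  classical
  have h := (hasPrimeMean_card_conj_mem hF ⊤).const_mul (Fintype.card Gal(L/ℚ) : ℝ)⁻¹
  have h0 : (Fintype.card Gal(L/ℚ) : ℝ) ≠ 0 := by exact_mod_cast Fintype.card_ne_zero
  simpa [h0] using h

theorem HasPrimeMean.nonpos {w : ℕ → ℝ} {c : ℝ} (h : HasPrimeMean w c) (N : ℕ)
    (hw : ∀ p, p.Prime → N < p → w p ≤ 0) : c ≤ 0 := by
  have h' := h.congr (w' := fun p => if N < p then w p else 0) N fun p _ hN => if_pos hN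
  refine le_of_tendsto h'.2 ?_
  filter_upwards [tendsto_neg_log_sub_one.eventually_ge_atTop 0] with s hs
  refine div_nonpos_of_nonpos_of_nonneg (tsum_nonpos fun p => ?_) hs
  refine mul_nonpos_of_nonpos_of_nonneg ?_ (Real.rpow_nonneg (Nat.cast_nonneg _) _)
  split_ifs with hN
  · exact hw p p.2 hN
  · exact le_rfl

theorem exists_root_sub_intCast_mem {L : Type*} [Field L] [NumberField L] {g : Polynomial ℤ}
    (hg : g.Monic) (hs : (g.map (algebraMap ℤ L)).Splits) {Q : Ideal (𝓞 L)} (hQ : Q.IsPrime) {t : ℤ}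
    (ht : ((g.eval t : ℤ) : 𝓞 L) ∈ Q) : ∃ γ : 𝓞 L, Polynomial.aeval γ g = 0 ∧ γ - t ∈ Q := by
  have hinteg (a : {a // a ∈ (g.map (algebraMap ℤ L)).roots}) :
      ∃ b : 𝓞 L, algebraMap (𝓞 L) L b = a := by
    refine ⟨⟨a, g, hg, ?_⟩, rfl⟩
    have := (Polynomial.mem_roots'.1 a.2).2
    rwa [Polynomial.IsRoot.def, Polynomial.eval_map] at this
  choose b hb using hinteg
  have hprod : ((g.map (algebraMap ℤ L)).roots.attach.map fun a => ((t : 𝓞 L) - b a)).prod =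
      ((g.eval t : ℤ) : 𝓞 L) := by
    apply FaithfulSMul.algebraMap_injective (𝓞 L) L
    rw [map_multiset_prod, Multiset.map_map, map_intCast]
    have h1 : (algebraMap ℤ L) (g.eval t) = (g.map (algebraMap ℤ L)).eval ((algebraMap ℤ L) t) := by
      rw [Polynomial.eval_map, Polynomial.eval₂_at_apply]
    rw [eq_intCast, eq_intCast] at h1
    rw [h1]
    conv_rhs => rw [hs.eq_prod_roots_of_monic (hg.map _), Polynomial.eval_multiset_prod,
      Multiset.map_map]
    rw [← Multiset.attach_map_val' (g.map (algebraMap ℤ L)).roots]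
    congr 1
    refine Multiset.map_congr rfl fun a _ => ?_
    simp [hb]
  rw [← hprod, hQ.multiset_prod_mem_iff_exists_mem] at ht
  obtain ⟨_, h, ha⟩ := ht
  obtain ⟨a, -, rfl⟩ := Multiset.mem_map.1 h
  refine ⟨b a, ?_, by simpa using Q.neg_mem ha⟩
  apply FaithfulSMul.algebraMap_injective (𝓞 L) L
  rw [map_zero, ← Polynomial.aeval_algebraMap_apply, hb]
  have := (Polynomial.mem_roots'.1 a.2).2
  rwa [Polynomial.IsRoot.def, Polynomial.eval_map_algebraMap] at this

theorem intCast_mem_iff_dvd {R : Type*} [CommRing R] {p : ℕ} (hp : p.Prime) {Q : Ideal R}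
    (hQ : Q ≠ ⊤) (hpQ : (p : R) ∈ Q) (c : ℤ) : (c : R) ∈ Q ↔ (p : ℤ) ∣ c := by
  rw [← Ideal.mem_span_singleton, ← under_int_eq_span hp hQ hpQ, Ideal.under, Ideal.mem_comap,
    eq_intCast]

open Classical in
theorem exists_dvd_eval_of_density {L : Type*} [Field L] [NumberField L] [IsGalois ℚ L]
    {g : Polynomial ℤ} (hg : g.Monic) (hs : (g.map (algebraMap ℤ L)).Splits)
    (hd : Tendsto (fun X : ℕ =>
      (((Finset.range (X + 1)).filter fun p : ℕ => p.Prime ∧ ¬∃ t : ℤ, (p : ℤ) ∣ g.eval t).card : ℝ) /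
      ((Finset.range (X + 1)).filter fun p : ℕ => p.Prime).card) atTop (𝓝 0)) :
    ∃ N : ℕ, ∀ p : ℕ, p.Prime → N < p → ∃ t : ℤ, (p : ℤ) ∣ g.eval t := by
  have hex (p : ℕ) : ∃ (Q : Ideal (𝓞 L)) (F : Gal(L/ℚ)), p.Prime → IsFrobeniusAt p Q F := by
    by_cases hp : p.Prime
    · obtain ⟨Q, F, h⟩ := exists_isFrobeniusAt (L := L) hp
      exact ⟨Q, F, fun _ => h⟩
    · exact ⟨⊥, 1, fun h => absurd h hp⟩
  choose Q F hF using hex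
  have hfin : {γ : 𝓞 L | Polynomial.aeval γ g = 0}.Finite := by
    refine (g.rootSet_finite (𝓞 L)).subset fun γ hγ => ?_
    exact (Polynomial.mem_rootSet_of_ne hg.ne_zero).2 hγ
  obtain ⟨N, hN⟩ := exists_forall_eq_of_sub_mem _ hfin
  have hstab (σ : Gal(L/ℚ)) (γ : 𝓞 L) (hγ : Polynomial.aeval γ g = 0) :
      Polynomial.aeval (σ • γ) g = 0 := by
    rw [Polynomial.aeval_smul, hγ, smul_zero]
  have hroot (σ : Gal(L/ℚ)) : ∃ γ : 𝓞 L, Polynomial.aeval γ g = 0 ∧ σ • γ = γ := by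
    by_contra! hσ
    have h1 := (hasPrimeMean_card_zpowers_conj hF (Subgroup.zpowers σ)).sub
      ((hasPrimeMean_zero_of_tendsto _ (hasPrimeMean_one hF) hd).const_mul (Fintype.card Gal(L/ℚ) : ℝ))
    have h2 := h1.nonpos N fun p hp hpN => ?_
    · rw [mul_zero, sub_zero] at h2
      have h3 : 0 < (Finset.univ.filter fun x => Subgroup.zpowers x = Subgroup.zpowers σ).card :=
        Finset.card_pos.2 ⟨σ, by simp⟩
      exact absurd h2 (not_le.2 (by exact_mod_cast h3))
    · by_cases hP : ¬∃ t : ℤ, (p : ℤ) ∣ g.eval t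
      · rw [if_pos hP, mul_one, sub_nonpos]
        exact_mod_cast Finset.card_le_univ _
      · obtain ⟨t, ht⟩ := not_not.1 hP
        rw [if_neg hP, mul_zero, sub_zero]
        refine le_of_eq ?_
        rw [Nat.cast_eq_zero, Finset.card_eq_zero, Finset.filter_eq_empty_iff]
        intro x _ hx
        have hFp := hF p hp
        obtain ⟨γ, hγ, hγt⟩ := exists_root_sub_intCast_mem hg hs hFp.1
          ((intCast_mem_iff_dvd hp hFp.1.ne_top hFp.2.1 _).2 ht)
        have hfix : F p • γ = γ := hN p hp hpN _ hFp.1 hFp.2.1 _ (hstab _ _ hγ) _ hγ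
          (hFp.smul_sub_mem hp hγt)
        refine hσ (x⁻¹ • γ) (hstab _ _ hγ) ?_
        have h4 : x⁻¹ * F p * x ∈ MulAction.stabilizer Gal(L/ℚ) (x⁻¹ • γ) := by
          rw [MulAction.mem_stabilizer_iff, mul_smul, mul_smul, smul_inv_smul, hfix]
        have h5 := Subgroup.zpowers_le.2 h4
        rw [hx, Subgroup.zpowers_le] at h5
        exact h5
  refine ⟨0, fun p hp _ => ?_⟩
  have hFp := hF p hp
  obtain ⟨γ, hγ, hfix⟩ := hroot (F p)
  obtain ⟨c, hc⟩ := exists_sub_intCast_mem hp hFp.1 hFp.2.1 (hFp.pow_sub_mem_of_smul_eq hfix)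
  refine ⟨c, (intCast_mem_iff_dvd hp hFp.1.ne_top hFp.2.1 _).1 ?_⟩
  have h1 := Polynomial.sub_dvd_eval_sub γ (c : 𝓞 L) (g.map (algebraMap ℤ (𝓞 L)))
  rw [Polynomial.eval_map_algebraMap, hγ, zero_sub, dvd_neg] at h1
  have h2 : Polynomial.eval (c : 𝓞 L) (g.map (algebraMap ℤ (𝓞 L))) = ((g.eval c : ℤ) : 𝓞 L) := by
    rw [Polynomial.eval_intCast_map, eq_intCast, Int.cast_id]
  rw [h2] at h1
  exact Q p |>.mem_of_dvd h1 hc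

end Chebotarev

section WeaklyIntersective

theorem integralNormalization_eval_leadingCoeff_mul {f : Polynomial ℤ} (hf : 0 < f.natDegree)
    (t : ℤ) : f.integralNormalization.eval (f.leadingCoeff * t) =
      f.leadingCoeff ^ (f.natDegree - 1) * f.eval t := by
  have := Polynomial.integralNormalization_eval₂_leadingCoeff_mul (p := f) hf (RingHom.id ℤ) t
  simpa [Polynomial.eval₂_eq_eval_map] using this

theorem exists_dvd_eval_of_integralNormalization {f : Polynomial ℤ} (hf : 0 < f.natDegree) {p : ℕ}
    (hp : p.Prime) (hpf : ¬ (p : ℤ) ∣ f.leadingCoeff) {u : ℤ}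
    (hu : (p : ℤ) ∣ f.integralNormalization.eval u) : ∃ t : ℤ, (p : ℤ) ∣ f.eval t := by
  have hpr : Prime (p : ℤ) := Nat.prime_iff_prime_int.1 hp
  have hc : IsCoprime f.leadingCoeff (p : ℤ) := ((hpr.coprime_iff_not_dvd).2 hpf).symm
  obtain ⟨a, b, hab⟩ := hc
  have h1 : (p : ℤ) ∣ f.leadingCoeff * (a * u) - u := ⟨- b * u, by linear_combination u * hab⟩
  have h2 := (dvd_add_right hu).2 (h1.trans (Polynomial.sub_dvd_eval_sub _ _ f.integralNormalization))
  rw [add_sub_cancel, integralNormalization_eval_leadingCoeff_mul hf] at h2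
  exact ⟨_, (hpr.dvd_or_dvd h2).resolve_left fun h => hpf (hpr.dvd_of_dvd_pow h)⟩

theorem exists_zmod_root_iff (f : Polynomial ℤ) (p : ℕ) :
    (∃ x : ZMod p, Polynomial.aeval x f = 0) ↔ ∃ t : ℤ, (p : ℤ) ∣ f.eval t := by
  rw [(ZMod.intCast_surjective (n := p)).exists]
  refine exists_congr fun t => ?_
  rw [← ZMod.intCast_zmod_eq_zero_iff_dvd, ← eq_intCast (algebraMap ℤ (ZMod p)),
    Polynomial.aeval_algebraMap_apply, eq_intCast, Polynomial.coe_aeval_eq_eval]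

theorem WeaklyIntersective.exists_dvd_eval {f : Polynomial ℤ} (hwi : WeaklyIntersective f)
    (hf : 0 < f.natDegree) :
    ∃ N : ℕ, ∀ p : ℕ, p.Prime → N < p → ∃ t : ℤ, (p : ℤ) ∣ f.eval t := by
  classical
  have hf0 : f ≠ 0 := by rintro rfl; simp at hf
  set g := f.integralNormalization with hgdef
  have hg : g.Monic := Polynomial.monic_integralNormalization hf0
  set L := (g.map (algebraMap ℤ ℚ)).SplittingField
  have : NumberField L := { }
  have : Polynomial.IsSplittingField ℚ L (g.map (algebraMap ℤ ℚ)) :=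
    Polynomial.IsSplittingField.splittingField _
  have : Normal ℚ L := Normal.of_isSplittingField (g.map (algebraMap ℤ ℚ))
  have : IsGalois ℚ L := { }
  have hs : (g.map (algebraMap ℤ L)).Splits := by
    have := Polynomial.SplittingField.splits (g.map (algebraMap ℤ ℚ))
    rwa [Polynomial.map_map, ← IsScalarTower.algebraMap_eq] at this
  have hlc : f.leadingCoeff.natAbs ≠ 0 := Int.natAbs_ne_zero.2 (Polynomial.leadingCoeff_ne_zero.2 hf0)
  have hlp (p : ℕ) (h : f.leadingCoeff.natAbs < p) : ¬ (p : ℤ) ∣ f.leadingCoeff := fun h' =>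
    (Nat.le_of_dvd (Nat.pos_of_ne_zero hlc) (Int.natCast_dvd.1 h')).not_gt h
  suffices hd : ∃ N : ℕ, ∀ p : ℕ, p.Prime → N < p → ∃ t : ℤ, (p : ℤ) ∣ g.eval t by
    obtain ⟨N, hN⟩ := hd
    refine ⟨max N f.leadingCoeff.natAbs, fun p hp hpN => ?_⟩
    obtain ⟨u, hu⟩ := hN p hp ((le_max_left _ _).trans_lt hpN)
    exact exists_dvd_eval_of_integralNormalization hf hp
      (hlp p ((le_max_right _ _).trans_lt hpN)) hu
  refine exists_dvd_eval_of_density hg hs ?_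
  have h1 : Tendsto (fun X : ℕ => 1 -
      (Nat.card {ℓ : ℕ // ℓ ≤ X ∧ ℓ.Prime ∧ ∃ x : ZMod ℓ, Polynomial.aeval x f = 0} : ℝ) /
      (Nat.card {ℓ : ℕ // ℓ ≤ X ∧ ℓ.Prime} : ℝ)) atTop (𝓝 0) := by
    simpa using hwi.const_sub 1
  refine squeeze_zero (fun X => by positivity) (fun X => ?_) h1
  have e1 : Nat.card {ℓ : ℕ // ℓ ≤ X ∧ ℓ.Prime} =
      ((Finset.range (X + 1)).filter fun p : ℕ => p.Prime).card :=
    Nat.subtype_card _ (by simp)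
  have e2 : Nat.card {ℓ : ℕ // ℓ ≤ X ∧ ℓ.Prime ∧ ∃ x : ZMod ℓ, Polynomial.aeval x f = 0} =
      ((Finset.range (X + 1)).filter fun p : ℕ => p.Prime ∧ ∃ t : ℤ, (p : ℤ) ∣ f.eval t).card :=
    Nat.subtype_card _ (by simp [exists_zmod_root_iff])
  rw [e1, e2]
  set S := (Finset.range (X + 1)).filter fun p : ℕ => p.Prime with hS
  rcases S.card.eq_zero_or_pos with h0 | h0
  · simp [h0]
  have h0' : (0 : ℝ) < S.card := by exact_mod_cast h0
  rw [one_sub_div h0'.ne', div_le_div_iff_of_pos_right h0', le_sub_iff_add_le]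
  rw [← Nat.cast_add, Nat.cast_le, ← Finset.card_union_of_disjoint]
  · refine Finset.card_le_card (Finset.union_subset ?_ ?_)
    · exact Finset.monotone_filter_right _ fun p _ h => h.1
    · exact Finset.monotone_filter_right _ fun p _ h => h.1
  · refine Finset.disjoint_filter.2 fun p _ h h' => h.2 ?_
    obtain ⟨t, ht⟩ := h'.2
    refine ⟨f.leadingCoeff * t, ?_⟩
    rw [integralNormalization_eval_leadingCoeff_mul hf]
    exact ht.mul_left _

end WeaklyIntersective

section LocalPoints

theorem exists_bezout_derivative {f : Polynomial ℤ}
    (hsf : Squarefree (f.map (Int.castRingHom ℚ))) :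
    ∃ (u v : Polynomial ℤ) (N : ℤ), N ≠ 0 ∧
      u * f + v * Polynomial.derivative f = Polynomial.C N := by
  have h1 := PerfectField.separable_iff_squarefree.2 hsf
  rw [Polynomial.separable_def, Polynomial.derivative_map] at h1
  obtain ⟨a, b, hab⟩ := h1
  obtain ⟨m, hm, hma⟩ := IsLocalization.integerNormalization_spec (nonZeroDivisors ℤ) a
  obtain ⟨n, hn, hnb⟩ := IsLocalization.integerNormalization_spec (nonZeroDivisors ℤ) b
  set A := IsLocalization.integerNormalization (nonZeroDivisors ℤ) a
  set B := IsLocalization.integerNormalization (nonZeroDivisors ℤ) b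
  refine ⟨Polynomial.C n * A, Polynomial.C m * B, m * n,
    mul_ne_zero (nonZeroDivisors.ne_zero hm) (nonZeroDivisors.ne_zero hn), ?_⟩
  apply Polynomial.map_injective (Int.castRingHom ℚ) Int.cast_injective
  rw [algebraMap_int_eq, zsmul_eq_mul] at hma hnb
  simp only [Polynomial.map_add, Polynomial.map_mul, hma, hnb, eq_intCast,
    Int.cast_mul, Polynomial.map_intCast]
  linear_combination (m : Polynomial ℚ) * (n : Polynomial ℚ) * hab

theorem exists_forall_not_dvd_eval_derivative {f : Polynomial ℤ}
    (hsf : Squarefree (f.map (Int.castRingHom ℚ))) :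
    ∃ N : ℕ, ∀ p : ℕ, p.Prime → N < p → ∀ t : ℤ, (p : ℤ) ∣ f.eval t →
      ¬ (p : ℤ) ∣ (Polynomial.derivative f).eval t := by
  obtain ⟨u, v, N, hN0, hN⟩ := exists_bezout_derivative hsf
  refine ⟨N.natAbs, fun p hp hpN t h h' => ?_⟩
  have h1 := congrArg (Polynomial.eval t) hN
  rw [Polynomial.eval_add, Polynomial.eval_mul, Polynomial.eval_mul, Polynomial.eval_C] at h1
  have h2 : (p : ℤ) ∣ N := h1 ▸ dvd_add (h.mul_left _) (h'.mul_left _)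
  exact (Nat.le_of_dvd (Int.natAbs_pos.2 hN0) (Int.natCast_dvd.1 h2)).not_gt hpN

theorem exists_padicInt_root {f : Polynomial ℤ} {p : ℕ} [Fact p.Prime] {t : ℤ}
    (h : (p : ℤ) ∣ f.eval t) (h' : ¬ (p : ℤ) ∣ (Polynomial.derivative f).eval t) :
    ∃ z : ℤ_[p], Polynomial.aeval z f = 0 := by
  have e (g : Polynomial ℤ) : Polynomial.aeval (t : ℤ_[p]) g = ((g.eval t : ℤ) : ℤ_[p]) := by
    rw [← eq_intCast (algebraMap ℤ ℤ_[p]), Polynomial.aeval_algebraMap_apply, eq_intCast,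
      Polynomial.coe_aeval_eq_eval]
  obtain ⟨z, hz, -⟩ := hensels_lemma (F := f) (a := (t : ℤ_[p])) (by
    rw [e, e]
    have h1 : ‖(((Polynomial.derivative f).eval t : ℤ) : ℤ_[p])‖ = 1 :=
      le_antisymm (PadicInt.norm_le_one _)
        (not_lt.1 fun hlt => h' ((PadicInt.norm_int_lt_one_iff_dvd _).1 hlt))
    rw [h1, one_pow]
    exact (PadicInt.norm_int_lt_one_iff_dvd _).2 h)
  exact ⟨z, hz⟩

theorem exists_padicInt_pow_eq {n : ℕ} (hn : n ≠ 0) {p : ℕ} [hp : Fact p.Prime] {m : ℤ}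
    (h : (p : ℤ) * n ^ 2 ∣ m - 1) : ∃ w : ℤ_[p], w ^ n = m := by
  have hn0 : 0 < ‖(n : ℤ_[p])‖ := norm_pos_iff.2 (by exact_mod_cast hn)
  obtain ⟨z, hz, -⟩ := hensels_lemma (p := p)
    (F := (Polynomial.X ^ n - Polynomial.C m : Polynomial ℤ)) (a := 1) (by
      obtain ⟨k, hk⟩ := h
      have e : (1 : ℤ_[p]) - m = -(p * n ^ 2 * k) := by
        have : ((m - 1 : ℤ) : ℤ_[p]) = ((p * n ^ 2 * k : ℤ) : ℤ_[p]) := by rw [hk]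
        push_cast at this
        linear_combination -this
      simp only [map_sub, map_pow, Polynomial.aeval_X, one_pow, eq_intCast,
        Polynomial.derivative_X_pow, Polynomial.derivative_intCast, sub_zero,
        map_mul, map_natCast, mul_one, e, map_intCast]
      rw [norm_neg, norm_mul, norm_mul, norm_pow]
      have hp1 : ‖(p : ℤ_[p])‖ < 1 := (PadicInt.norm_natCast_lt_one_iff.2 (dvd_refl p))
      have hk1 : ‖(k : ℤ_[p])‖ ≤ 1 := PadicInt.norm_le_one _
      calc ‖(p : ℤ_[p])‖ * ‖(n : ℤ_[p])‖ ^ 2 * ‖(k : ℤ_[p])‖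
          ≤ ‖(p : ℤ_[p])‖ * ‖(n : ℤ_[p])‖ ^ 2 * 1 := by gcongr
        _ < 1 * ‖(n : ℤ_[p])‖ ^ 2 := by rw [mul_one]; gcongr
        _ = _ := one_mul _)
  refine ⟨z, ?_⟩
  simpa [sub_eq_zero] using hz

theorem hasTwistPoint_of_pow_eq {n : ℕ} {f : Polynomial ℤ} {K : Type} [Field K] [CharZero K]
    {x d z m : ℤ} (hx : f.eval x = d * z ^ n) (hm : m ≠ 0) (h : ∃ w : K, w ^ n = m) :
    HasTwistPoint n f (d * m) K := by
  obtain ⟨w, hw⟩ := h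
  refine ⟨x, z / w, ?_⟩
  have hm' : (m : K) ≠ 0 := by exact_mod_cast hm
  rw [← eq_intCast (algebraMap ℤ K) x, Polynomial.aeval_algebraMap_apply, eq_intCast,
    Polynomial.coe_aeval_eq_eval, hx, div_pow, hw]
  push_cast
  field_simp

theorem exists_forall_everywhereLocallySoluble {n : ℕ} (hn : n ≠ 0) {f : Polynomial ℤ}
    (hf : 0 < f.natDegree) (hsf : Squarefree (f.map (Int.castRingHom ℚ)))
    (hwi : WeaklyIntersective f) : ∃ M : ℕ, 0 < M ∧ ∀ x d z m : ℤ, f.eval x = d * z ^ n →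
      0 < m → (M : ℤ) ∣ m - 1 → EverywhereLocallySoluble n f (d * m) := by
  obtain ⟨N₁, hN₁⟩ := hwi.exists_dvd_eval hf
  obtain ⟨N₂, hN₂⟩ := exists_forall_not_dvd_eval_derivative hsf
  refine ⟨(max N₁ N₂).factorial * n ^ 2, by positivity, fun x d z m hx hm hM => ⟨?_, fun p hp => ?_⟩⟩
  · refine hasTwistPoint_of_pow_eq hx hm.ne' ⟨(m : ℝ) ^ (n : ℝ)⁻¹, ?_⟩
    exact Real.rpow_inv_natCast_pow (by exact_mod_cast hm.le) hn
  · rcases le_or_gt p (max N₁ N₂) with h | h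
    · refine hasTwistPoint_of_pow_eq hx hm.ne' ?_
      have h1 : (p : ℤ) * n ^ 2 ∣ m - 1 := by
        refine dvd_trans ?_ hM
        push_cast
        exact mul_dvd_mul_right (Int.natCast_dvd_natCast.2 (Nat.dvd_factorial hp.out.pos h)) _
      obtain ⟨w, hw⟩ := exists_padicInt_pow_eq hn h1
      exact ⟨(w : ℚ_[p]), by exact_mod_cast congrArg (PadicInt.Coe.ringHom (p := p)) hw⟩
    · obtain ⟨t, ht⟩ := hN₁ p hp.out ((le_max_left _ _).trans_lt h)
      obtain ⟨y, hy⟩ := exists_padicInt_root ht (hN₂ p hp.out ((le_max_right _ _).trans_lt h) t ht)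
      refine ⟨(y : ℚ_[p]), 0, ?_⟩
      rw [zero_pow hn, mul_zero]
      have := Polynomial.aeval_algebraMap_apply ℚ_[p] y f
      rw [hy, map_zero] at this
      exact this.symm

end LocalPoints

section PowerFree

theorem exists_eq_mul_pow_nthPowerFree {n : ℕ} (hn : n ≠ 0) (a : ℤ) (ha : a ≠ 0) :
    ∃ d z : ℤ, a = d * z ^ n ∧ NthPowerFree n d := by
  induction hk : a.natAbs using Nat.strong_induction_on generalizing a with
  | _ k ih =>
    by_cases h : NthPowerFree n a
    · exact ⟨a, 1, by simp, h⟩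
    · obtain ⟨p, hp, b, hb⟩ : ∃ p : ℕ, p.Prime ∧ (p : ℤ) ^ n ∣ a := by
        by_contra! hcon
        exact h ⟨ha, hcon⟩
      have hb0 : b ≠ 0 := by
        rintro rfl
        exact ha (by simpa using hb)
      have hlt : b.natAbs < k := by
        rw [← hk, hb, Int.natAbs_mul, Int.natAbs_pow, Int.natAbs_natCast]
        exact lt_mul_of_one_lt_left (Int.natAbs_pos.2 hb0) (Nat.one_lt_pow hn hp.one_lt)
      obtain ⟨d, z, hbd, hd⟩ := ih _ hlt b hb0 rfl
      exact ⟨d, p * z, by rw [hb, hbd]; ring, hd⟩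

theorem NthPowerFree.mul_squarefree {n : ℕ} (hn : 2 ≤ n) {d : ℤ} (hd : NthPowerFree n d)
    {m : ℕ} (hm : Squarefree m) (hdm : d ∣ (m : ℤ) - 1) : NthPowerFree n (d * m) := by
  refine ⟨mul_ne_zero hd.1 (by exact_mod_cast hm.ne_zero), fun p hp hpn ↦ ?_⟩
  have hpp : Prime (p : ℤ) := Nat.prime_iff_prime_int.1 hp
  by_cases hpm : (p : ℤ) ∣ m
  · have hpd : ¬ (p : ℤ) ∣ d := fun h ↦ hpp.not_dvd_one (by
      have := dvd_sub hpm (h.trans hdm)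
      simpa using this)
    have h1 : (p : ℤ) ^ n ∣ m :=
      (hpp.coprime_iff_not_dvd.2 hpd).pow_left.dvd_of_dvd_mul_left hpn
    have h2 : p ^ 2 ∣ m := by
      have := (pow_dvd_pow (p : ℤ) hn).trans h1
      exact_mod_cast this
    exact Nat.squarefree_iff_prime_squarefree.1 hm p hp (by rwa [← sq])
  · exact hd.2 p hp ((hpp.coprime_iff_not_dvd.2 hpm).pow_left.dvd_of_dvd_mul_right hpn)

theorem exists_eval_ne_zero {f : ℤ[X]} (hf : 0 < f.natDegree) : ∃ x : ℤ, f.eval x ≠ 0 := by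
  by_contra! h
  have : f = 0 := Polynomial.funext fun x ↦ by simpa using h x
  simp [this] at hf

end PowerFree

section SquarefreeCount

theorem card_filter_dvd_one_add_mul_le (M J r : ℕ) (hr : 0 < r) :
    ((Finset.range J).filter fun j ↦ r ∣ 1 + M * j).card ≤ J / r + 1 := by
  by_cases hne : ∃ j₀, r ∣ 1 + M * j₀
  · obtain ⟨j₀, hj₀⟩ := hne
    have hcop : Nat.gcd r M = 1 := by
      have h1 : Nat.gcd r M ∣ 1 + M * j₀ := (Nat.gcd_dvd_left r M).trans hj₀
      have h2 : Nat.gcd r M ∣ M * j₀ := (Nat.gcd_dvd_right r M).mul_right _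
      exact Nat.dvd_one.1 ((Nat.dvd_add_left h2).1 h1)
    calc _ ≤ ((Finset.range J).filter fun j ↦ j ≡ j₀ [MOD r]).card := by
          refine Finset.card_le_card fun j hj ↦ ?_
          simp only [Finset.mem_filter] at hj ⊢
          refine ⟨hj.1, ?_⟩
          have h1 : 1 + M * j ≡ 1 + M * j₀ [MOD r] :=
            (Nat.modEq_zero_iff_dvd.2 hj.2).trans (Nat.modEq_zero_iff_dvd.2 hj₀).symm
          exact Nat.ModEq.cancel_left_of_coprime hcop (Nat.ModEq.add_left_cancel' 1 h1)
      _ = Nat.count (· ≡ j₀ [MOD r]) J := (Nat.count_eq_card_filter_range _ _).symm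
      _ ≤ _ := by
          rw [Nat.count_modEq_card J hr j₀]
          split_ifs <;> omega
  · rw [Finset.filter_false_of_mem fun j _ h ↦ hne ⟨j, h⟩]
    simp

theorem sum_Icc_one_div_sq_le (s : ℕ) (hs : 2 ≤ s) :
    ∑ q ∈ Finset.Icc 2 s, (1 / (q : ℝ) ^ 2) ≤ 3 / 4 - 1 / (s : ℝ) := by
  induction s, hs using Nat.le_induction with
  | base => norm_num
  | succ s hs ih =>
    rw [Finset.sum_Icc_succ_top (by omega)]
    have hs' : (0 : ℝ) < s := by positivity
    have : 1 / ((s + 1 : ℕ) : ℝ) ^ 2 ≤ 1 / s - 1 / ((s + 1 : ℕ) : ℝ) := by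
      push_cast
      rw [div_sub_div _ _ hs'.ne' (by positivity), div_le_div_iff₀ (by positivity) (by positivity)]
      nlinarith
    linarith

theorem le_eight_mul_card_squarefree {M J : ℕ} (hJ : 64 * M + 64 ≤ J) :
    J ≤ 8 * ((Finset.range J).filter fun j ↦ Squarefree (1 + M * j)).card := by
  set s := Nat.sqrt (1 + M * J) with hs
  have hs8 : 8 * s ≤ J := by
    have h1 : s ^ 2 ≤ 1 + M * J := Nat.sqrt_le' _
    by_contra! h
    nlinarith
  have hbad : ((Finset.range J).filter fun j ↦ ¬ Squarefree (1 + M * j)) ⊆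
      (Finset.Icc 2 s).biUnion fun q ↦ (Finset.range J).filter fun j ↦ q ^ 2 ∣ 1 + M * j := by
    intro j hj
    simp only [Finset.mem_filter, Finset.mem_range, Nat.squarefree_iff_prime_squarefree, not_forall,
      not_not] at hj
    obtain ⟨hjJ, q, hq, hqd⟩ := hj
    simp only [Finset.mem_biUnion, Finset.mem_Icc, Finset.mem_filter, Finset.mem_range]
    refine ⟨q, ⟨hq.two_le, ?_⟩, hjJ, by rwa [sq]⟩
    refine Nat.le_sqrt.2 ((Nat.le_of_dvd (by omega) hqd).trans ?_)
    gcongr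
  have hcard : (((Finset.range J).filter fun j ↦ ¬ Squarefree (1 + M * j)).card : ℝ) ≤
      J * (3 / 4) + s := by
    have h1 := (Finset.card_le_card hbad).trans (Finset.card_biUnion_le.trans
      (Finset.sum_le_sum fun q hq ↦ card_filter_dvd_one_add_mul_le M J (q ^ 2)
        (pow_pos (by have := (Finset.mem_Icc.1 hq).1; omega) 2)))
    have h2 : ((∑ q ∈ Finset.Icc 2 s, (J / q ^ 2 + 1) : ℕ) : ℝ) ≤
        J * ∑ q ∈ Finset.Icc 2 s, (1 / (q : ℝ) ^ 2) + s := by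
      rw [Finset.sum_add_distrib, Finset.mul_sum]
      push_cast
      refine add_le_add (Finset.sum_le_sum fun q _ ↦ ?_) ?_
      · refine (Nat.cast_div_le).trans (le_of_eq ?_)
        push_cast
        ring
      · simp only [Finset.sum_const, Nat.card_Icc, nsmul_eq_mul, mul_one, Nat.cast_le]
        omega
    have h3 : ∑ q ∈ Finset.Icc 2 s, (1 / (q : ℝ) ^ 2) ≤ 3 / 4 := by
      rcases lt_or_ge s 2 with h | h
      · rw [Finset.Icc_eq_empty (by omega)]
        norm_num
      · exact (sum_Icc_one_div_sq_le s h).trans (by simp)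
    calc _ ≤ ((∑ q ∈ Finset.Icc 2 s, (J / q ^ 2 + 1) : ℕ) : ℝ) := by exact_mod_cast h1
      _ ≤ _ := h2
      _ ≤ _ := by gcongr
  have htot := Finset.card_filter_add_card_filter_not (s := Finset.range J)
    (fun j ↦ Squarefree (1 + M * j))
  rw [Finset.card_range] at htot
  have htot' : (((Finset.range J).filter fun j ↦ Squarefree (1 + M * j)).card : ℝ) +
      ((Finset.range J).filter fun j ↦ ¬ Squarefree (1 + M * j)).card = J := by
    exact_mod_cast htot
  have hs8' : (8 : ℝ) * s ≤ J := by exact_mod_cast hs8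
  have : (J : ℝ) ≤ 8 * ((Finset.range J).filter fun j ↦ Squarefree (1 + M * j)).card := by
    linarith
  exact_mod_cast this

end SquarefreeCount

end PrimeDensities

/-- For a weakly intersective squarefree polynomial, a positive proportion of
the twists `d·y^n = f(x)` are everywhere locally soluble. -/
theorem stmt_7 (n : ℕ) (hn : 2 ≤ n) (f : Polynomial ℤ) (hnc : 0 < f.natDegree)
    (hsf : Squarefree (f.map (Int.castRingHom ℚ))) (hwi : WeaklyIntersective f) :
    ∃ c : ℝ, 0 < c ∧ ∃ X₀ : ℝ, ∀ X : ℝ, X₀ ≤ X →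
      c * X ≤
        ({d : ℤ | |(d : ℝ)| ≤ X ∧ NthPowerFree n d ∧
            EverywhereLocallySoluble n f d}.ncard : ℝ) := by
  obtain ⟨x, hx⟩ := exists_eval_ne_zero hnc
  obtain ⟨d, z, hdz, hd⟩ := exists_eq_mul_pow_nthPowerFree (n := n) (by omega) _ hx
  obtain ⟨M, hM, hsol⟩ := exists_forall_everywhereLocallySoluble (n := n) (by omega) hnc hsf hwi
  set D := d.natAbs with hD
  have hD0 : 0 < D := Int.natAbs_pos.2 hd.1
  set N := M * D with hN
  have hN0 : 0 < N := Nat.mul_pos hM hD0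
  have hDN : (0 : ℝ) < D * N := by positivity
  refine ⟨1 / (16 * (D * N)), by positivity, D * N * (64 * N + 65), fun X hX ↦ ?_⟩
  set J := ⌊X / (D * N)⌋₊ with hJ
  have hXJ : (64 * N + 65 : ℝ) ≤ X / (D * N) := by
    rw [le_div_iff₀ hDN]
    linarith
  have hJX : (J : ℝ) ≤ X / (D * N) := Nat.floor_le ((by positivity : (0 : ℝ) ≤ _).trans hXJ)
  have hJX' : X / (D * N) < J + 1 := Nat.lt_floor_add_one _
  have hJ64 : 64 * N + 64 ≤ J := by
    refine Nat.le_floor ?_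
    push_cast
    linarith
  set S := (Finset.range J).filter fun j ↦ Squarefree (1 + N * j)
  have hcount : (J : ℝ) ≤ 8 * S.card := by exact_mod_cast le_eight_mul_card_squarefree hJ64
  have hinj : Function.Injective fun j : ℕ ↦ d * ((1 + N * j : ℕ) : ℤ) := by
    intro i j hij
    have h1 : 1 + N * i = 1 + N * j := by exact_mod_cast mul_left_cancel₀ hd.1 hij
    exact Nat.eq_of_mul_eq_mul_left hN0 (Nat.add_left_cancel h1)
  have hsub : ((S.image fun j : ℕ ↦ d * ((1 + N * j : ℕ) : ℤ) : Finset ℤ) : Set ℤ) ⊆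
      {d : ℤ | |(d : ℝ)| ≤ X ∧ NthPowerFree n d ∧ EverywhereLocallySoluble n f d} := by
    intro e he
    simp only [Finset.coe_image, Set.mem_image, Finset.mem_coe] at he
    obtain ⟨j, hj, rfl⟩ := he
    obtain ⟨hjJ, hjs⟩ := Finset.mem_filter.1 hj
    have hsub1 : ((1 + N * j : ℕ) : ℤ) - 1 = M * D * j := by
      rw [hN]
      push_cast
      ring
    refine ⟨?_, hd.mul_squarefree hn hjs ?_, hsol x d z _ hdz (by positivity) ?_⟩
    · have hle : 1 + N * j ≤ N * J := by
        have : j + 1 ≤ J := Finset.mem_range.1 hjJ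
        nlinarith
      have hle' : ((1 + N * j : ℕ) : ℝ) ≤ N * J := by exact_mod_cast hle
      have hd' : |(d : ℝ)| = D := by
        rw [hD, Nat.cast_natAbs, Int.cast_abs]
      rw [Int.cast_mul, abs_mul, hd', Int.cast_natCast, Nat.abs_cast]
      calc (D : ℝ) * ((1 + N * j : ℕ) : ℝ) ≤ D * (N * J) := by gcongr
        _ = J * (D * N) := by ring
        _ ≤ X := (le_div_iff₀ hDN).1 hJX
    · rw [hsub1]
      exact (Int.dvd_natAbs.2 dvd_rfl).mul_left _ |>.mul_right _
    · rw [hsub1, mul_assoc]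
      exact dvd_mul_right _ _
  have hfin : {d : ℤ | |(d : ℝ)| ≤ X ∧ NthPowerFree n d ∧
      EverywhereLocallySoluble n f d}.Finite := by
    refine (Set.finite_Icc (-⌊X⌋) ⌊X⌋).subset fun e he ↦ ?_
    have h := abs_le.1 he.1
    exact ⟨by rw [neg_le]; exact Int.le_floor.2 (by push_cast; linarith), Int.le_floor.2 h.2⟩
  have hle := Set.ncard_le_ncard hsub hfin
  rw [Set.ncard_coe_finset, Finset.card_image_of_injective _ hinj] at hle
  calc 1 / (16 * (D * N)) * X = X / (D * N) / 16 := by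
        field_simp
    _ ≤ S.card := by linarith
    _ ≤ _ := by exact_mod_cast hle
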